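/- Let n ≥ 1 and let Ω ⊂ ℝⁿ be a nonempty bounded open convex set with smooth boundary. Let F be a Minkowski norm on ℝⁿ and let d_F be the diameter of Ω with respect to the dual norm F⁰. Then for every function u that is continuously differentiable on a neighborhood of the closure of Ω and satisfies ∫_Ω u dx = 0, one has ∫_Ω F(∇u(x))² dx ≥ (π²/d_F²) ∫_Ω u(x)² dx. (Equivalently, the first nonzero Neumann eigenvalue of the Finsler–Laplacian satisfies λ₁ᴺ ≥ π²/d_F².) -/

import Mathlib

open Real MeasureTheory
open scoped RealInnerProductSpace

noncomputable section

/-- A Minkowski norm on ℝⁿ: nonnegative, convex, C¹ away from the origin, even,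
positively 1-homogeneous, and positive away from the origin. -/
structure IsMinkowskiNorm {n : ℕ} (F : EuclideanSpace ℝ (Fin n) → ℝ) : Prop where
  nonneg : ∀ ξ, 0 ≤ F ξ
  convexOn : ConvexOn ℝ Set.univ F
  contDiffOn : ContDiffOn ℝ 1 F {(0 : EuclideanSpace ℝ (Fin n))}ᶜ
  even : ∀ ξ, F (-ξ) = F ξ
  homog : ∀ (t : ℝ) (ξ : EuclideanSpace ℝ (Fin n)), F (t • ξ) = |t| * F ξ
  pos : ∀ ξ, ξ ≠ 0 → 0 < F ξ

/-- The dual norm `F⁰(x) = sup_{ξ ≠ 0} ⟨x, ξ⟩ / F(ξ)`. -/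
def dualNorm {n : ℕ} (F : EuclideanSpace ℝ (Fin n) → ℝ)
    (x : EuclideanSpace ℝ (Fin n)) : ℝ :=
  sSup {r : ℝ | ∃ ξ : EuclideanSpace ℝ (Fin n), ξ ≠ 0 ∧ r = ⟪x, ξ⟫ / F ξ}

/-- A set has smooth boundary: near each boundary point there is a smooth local defining
function with nonvanishing differential. -/
def HasSmoothBoundary {n : ℕ} (Ω : Set (EuclideanSpace ℝ (Fin n))) : Prop :=
  ∀ x ∈ frontier Ω, ∃ U ∈ nhds x, ∃ f : EuclideanSpace ℝ (Fin n) → ℝ,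
    ContDiff ℝ (⊤ : ℕ∞) f ∧ (∀ y ∈ U, (y ∈ Ω ↔ f y < 0)) ∧
      ∀ y ∈ U, y ∈ frontier Ω → fderiv ℝ f y ≠ 0

/-- Dirichlet spectral gap on an interval for a log-convex weight `exp V`. -/
lemma dirichlet_gap_of_convex_aux {A B k : ℝ} (hAB : A < B) (hk : 0 < k) (hkπ : k * (B - A) < π)
    {V V₁ V₂ g g' : ℝ → ℝ} (hV : ∀ x, HasDerivAt V (V₁ x) x) (hV₁ : ∀ x, HasDerivAt V₁ (V₂ x) x)
    (hV₂ : ∀ x, 0 ≤ V₂ x) (hgc : ContinuousOn g (Set.Icc A B))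
    (hg : ∀ x ∈ Set.Ioo A B, HasDerivAt g (g' x) x) (hg'c : ContinuousOn g' (Set.Icc A B))
    (hgA : g A = 0) (hgB : g B = 0) :
    k ^ 2 * ∫ x in A..B, exp (V x) * g x ^ 2 ≤ ∫ x in A..B, exp (V x) * g' x ^ 2 := by
  set m := (A + B) / 2 with hm
  have hVc : Continuous V := continuous_iff_continuousAt.2 fun x => (hV x).continuousAt
  have hV₁c : Continuous V₁ := continuous_iff_continuousAt.2 fun x => (hV₁ x).continuousAt
  have hcos : ∀ x ∈ Set.Icc A B, cos (k * (x - m)) ≠ 0 := by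
    rintro x ⟨h1, h2⟩
    apply ne_of_gt
    apply Real.cos_pos_of_mem_Ioo
    constructor <;> rw [hm] <;> nlinarith
  set W : ℝ → ℝ := fun x => exp (V x) * (-V₁ x / 2 - k * tan (k * (x - m))) * g x ^ 2 with hW
  have hWc : ContinuousOn W (Set.Icc A B) := by
    have htan : ContinuousOn (fun x => tan (k * (x - m))) (Set.Icc A B) := by
      intro x hx
      exact ((Real.continuousAt_tan.2 (hcos x hx)).comp
        (f := fun x => k * (x - m)) (by fun_prop)).continuousWithinAt
    fun_prop
  have hWd : ∀ x ∈ Set.Ioo A B, HasDerivAt W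
      ((exp (V x) * V₁ x * (-V₁ x / 2 - k * tan (k * (x - m))) +
        exp (V x) * (-V₂ x / 2 - k * ((1 / cos (k * (x - m)) ^ 2) * (k * 1)))) * g x ^ 2 +
        exp (V x) * (-V₁ x / 2 - k * tan (k * (x - m))) * (2 * g x ^ (2 - 1) * g' x)) x := by
    intro x hx
    have h1 : HasDerivAt (fun x => k * (x - m)) (k * 1) x :=
      ((hasDerivAt_id x).sub_const m).const_mul k
    have h2 := (Real.hasDerivAt_tan (hcos x (Set.Ioo_subset_Icc_self hx))).comp x h1
    have h3 := ((hV₁ x).neg.div_const 2).sub (h2.const_mul k)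
    exact (((hV x).exp.mul h3).mul ((hg x hx).pow 2))
  have hi1 : IntervalIntegrable (fun x => exp (V x) * g x ^ 2) volume A B := by
    apply ContinuousOn.intervalIntegrable
    rw [Set.uIcc_of_le hAB.le]
    fun_prop
  have hi2 : IntervalIntegrable (fun x => exp (V x) * g' x ^ 2) volume A B := by
    apply ContinuousOn.intervalIntegrable
    rw [Set.uIcc_of_le hAB.le]
    fun_prop
  have key := intervalIntegral.sub_le_integral_of_hasDeriv_right_of_le hAB.le hWc
    (fun x hx => (hWd x hx).hasDerivWithinAt)
    (φ := fun x => exp (V x) * g' x ^ 2 - k ^ 2 * (exp (V x) * g x ^ 2))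
    ((intervalIntegrable_iff_integrableOn_Icc_of_le hAB.le).1 (hi2.sub (hi1.const_mul _))) (by
      intro x hx
      have hc := hcos x (Set.Ioo_subset_Icc_self hx)
      have ht : 1 / cos (k * (x - m)) ^ 2 = 1 + tan (k * (x - m)) ^ 2 := by
        have := Real.sin_sq_add_cos_sq (k * (x - m))
        rw [Real.tan_eq_sin_div_cos, div_pow]
        field_simp
        linarith
      rw [ht]
      set T := tan (k * (x - m))
      have e0 := (exp_pos (V x)).le
      have s1 : 0 ≤ exp (V x) * (g' x - (-V₁ x / 2 - k * T) * g x) ^ 2 := by positivity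
      have s2 : 0 ≤ exp (V x) * V₂ x * g x ^ 2 / 2 := by
        have := hV₂ x
        positivity
      have s3 : 0 ≤ exp (V x) * V₁ x ^ 2 * g x ^ 2 / 4 := by positivity
      linarith)
  rw [intervalIntegral.integral_sub hi2 (hi1.const_mul _), intervalIntegral.integral_const_mul]
    at key
  have hWA : W A = 0 := by simp [hW, hgA]
  have hWB : W B = 0 := by simp [hW, hgB]
  linarith

lemma dirichlet_gap_of_convex {A B : ℝ} (hAB : A < B)
    {V V₁ V₂ g g' : ℝ → ℝ} (hV : ∀ x, HasDerivAt V (V₁ x) x) (hV₁ : ∀ x, HasDerivAt V₁ (V₂ x) x)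
    (hV₂ : ∀ x, 0 ≤ V₂ x) (hgc : ContinuousOn g (Set.Icc A B))
    (hg : ∀ x ∈ Set.Ioo A B, HasDerivAt g (g' x) x) (hg'c : ContinuousOn g' (Set.Icc A B))
    (hgA : g A = 0) (hgB : g B = 0) :
    (π / (B - A)) ^ 2 * ∫ x in A..B, exp (V x) * g x ^ 2
      ≤ ∫ x in A..B, exp (V x) * g' x ^ 2 := by
  have hBA : 0 < B - A := sub_pos.2 hAB
  have hK : 0 < π / (B - A) := by positivity
  have hlim : Filter.Tendsto (fun k : ℝ => k ^ 2 * ∫ x in A..B, exp (V x) * g x ^ 2)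
      (nhdsWithin (π / (B - A)) (Set.Iio (π / (B - A))))
      (nhds ((π / (B - A)) ^ 2 * ∫ x in A..B, exp (V x) * g x ^ 2)) := by
    apply Filter.Tendsto.mono_left _ nhdsWithin_le_nhds
    exact Continuous.tendsto (by fun_prop) _
  apply le_of_tendsto hlim
  filter_upwards [Ioo_mem_nhdsLT hK] with k hk
  exact dirichlet_gap_of_convex_aux hAB hk.1 ((lt_div_iff₀ hBA).1 hk.2) hV hV₁ hV₂ hgc hg hg'c
    hgA hgB

/-- The Payne–Weinberger inequality on an interval with the log-concave weight `exp (-V)`. -/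
lemma poincare_interval_of_convex {A B : ℝ} (hAB : A < B)
    {V V₁ V₂ f f' : ℝ → ℝ} (hV : ∀ x, HasDerivAt V (V₁ x) x) (hV₁ : ∀ x, HasDerivAt V₁ (V₂ x) x)
    (hV₂ : ∀ x, 0 ≤ V₂ x) (hfc : ContinuousOn f (Set.Icc A B))
    (hf : ∀ x ∈ Set.Ioo A B, HasDerivAt f (f' x) x) (hf'c : ContinuousOn f' (Set.Icc A B)) :
    (∫ x in A..B, exp (-V x)) * (∫ x in A..B, f x ^ 2 * exp (-V x)) -
        (∫ x in A..B, f x * exp (-V x)) ^ 2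
      ≤ ((B - A) / π) ^ 2 *
        ((∫ x in A..B, exp (-V x)) * ∫ x in A..B, f' x ^ 2 * exp (-V x)) := by
  have hVc : Continuous V := continuous_iff_continuousAt.2 fun x => (hV x).continuousAt
  have hII : ∀ {h : ℝ → ℝ}, ContinuousOn h (Set.Icc A B) → IntervalIntegrable h volume A B := by
    intro h hh
    apply ContinuousOn.intervalIntegrable
    rwa [Set.uIcc_of_le hAB.le]
  set P := ∫ x in A..B, exp (-V x) with hP
  have hPpos : 0 < P := by
    apply intervalIntegral.intervalIntegral_pos_of_pos_on (hII (by fun_prop)) _ hAB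
    intro x _
    positivity
  set m := (∫ x in A..B, f x * exp (-V x)) / P with hm
  have hmP : ∫ x in A..B, f x * exp (-V x) = m * P := by
    rw [hm]; field_simp
  set φ : ℝ → ℝ := fun x => (f x - m) * exp (-V x) with hφ
  have hφc : ContinuousOn φ (Set.Icc A B) := by fun_prop
  set g : ℝ → ℝ := fun x => ∫ t in A..x, φ t with hg
  have hgc : ContinuousOn g (Set.Icc A B) := by
    have := intervalIntegral.continuousOn_primitive_interval (μ := volume) (f := φ) (a := A) (b := B)
      (by rw [Set.uIcc_of_le hAB.le]; exact hφc.integrableOn_Icc)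
    rwa [Set.uIcc_of_le hAB.le] at this
  have hgd : ∀ x ∈ Set.Ioo A B, HasDerivAt g (φ x) x := by
    intro x hx
    apply intervalIntegral.integral_hasDerivAt_right
    · apply (hII hφc).mono_set
      rw [Set.uIcc_of_le hAB.le, Set.uIcc_of_le hx.1.le]
      exact Set.Icc_subset_Icc_right hx.2.le
    · exact (hφc.mono Set.Ioo_subset_Icc_self).stronglyMeasurableAtFilter isOpen_Ioo x hx
    · exact hφc.continuousAt (Icc_mem_nhds hx.1 hx.2)
  have hgA : g A = 0 := by simp [hg]
  have hgB : g B = 0 := by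
    simp only [hg, hφ, sub_mul]
    rw [intervalIntegral.integral_sub (hII (by fun_prop)) (hII (by fun_prop)),
      intervalIntegral.integral_const_mul, hmP]
    ring
  have hD := dirichlet_gap_of_convex hAB hV hV₁ hV₂ hgc hgd hφc hgA hgB
  set S := ∫ x in A..B, (f x - m) ^ 2 * exp (-V x) with hS
  have hSφ : ∫ x in A..B, exp (V x) * φ x ^ 2 = S := by
    apply intervalIntegral.integral_congr
    intro x _
    simp only [hφ, mul_pow, Real.exp_neg]
    field_simp
  rw [hSφ] at hD
  have hparts : ∫ x in A..B, (f' x * g x + (f x - m) * φ x) = 0 := by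
    have := intervalIntegral.integral_eq_sub_of_hasDerivAt_of_le hAB.le
      (f := fun x => (f x - m) * g x) (f' := fun x => f' x * g x + (f x - m) * φ x)
      (by fun_prop) (fun x hx => ((hf x hx).sub_const m).mul (hgd x hx)) (hII (by fun_prop))
    rw [this, hgA, hgB]
    ring
  rw [intervalIntegral.integral_add (hII (by fun_prop)) (hII (by fun_prop))] at hparts
  have hS2 : ∫ x in A..B, (f x - m) * φ x = S := by
    apply intervalIntegral.integral_congr
    intro x _
    simp only [hφ]
    ring
  rw [hS2] at hparts
  have hk : 0 < π / (B - A) := div_pos pi_pos (sub_pos.2 hAB)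
  set k := π / (B - A)
  have hk' : (B - A) / π = k⁻¹ := by simp [k]
  rw [hk']
  have hCS : ∫ x in A..B, (-2) * (f' x * g x) ≤
      ∫ x in A..B, ((k⁻¹) ^ 2 * (f' x ^ 2 * exp (-V x)) + k ^ 2 * (exp (V x) * g x ^ 2)) := by
    apply intervalIntegral.integral_mono_on hAB.le (hII (by fun_prop)) (hII (by fun_prop))
    intro x _
    have h1 : exp (-V x) * exp (V x) = 1 := by rw [← Real.exp_add]; simp
    have h2 : k⁻¹ * k = 1 := inv_mul_cancel₀ hk.ne'
    have h3 : 0 ≤ exp (-V x) * (k⁻¹ * f' x + k * exp (V x) * g x) ^ 2 := by positivity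
    have h4 : exp (-V x) * (k⁻¹ * f' x + k * exp (V x) * g x) ^ 2 =
        (k⁻¹) ^ 2 * (f' x ^ 2 * exp (-V x)) +
          k ^ 2 * ((exp (-V x) * exp (V x)) * exp (V x) * g x ^ 2) +
          2 * (k⁻¹ * k) * (exp (-V x) * exp (V x)) * (f' x * g x) := by ring
    rw [h1, h2] at h4
    linarith
  rw [intervalIntegral.integral_const_mul,
    intervalIntegral.integral_add (hII (by fun_prop)) (hII (by fun_prop)),
    intervalIntegral.integral_const_mul, intervalIntegral.integral_const_mul] at hCS
  have hmain : S ≤ (k⁻¹) ^ 2 * ∫ x in A..B, f' x ^ 2 * exp (-V x) := by linarith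
  have hSexp : S = (∫ x in A..B, f x ^ 2 * exp (-V x)) - m ^ 2 * P := by
    have : S = ∫ x in A..B, (f x ^ 2 * exp (-V x) - 2 * m * (f x * exp (-V x)) +
        m ^ 2 * exp (-V x)) := by
      apply intervalIntegral.integral_congr
      intro x _
      simp only
      ring
    rw [this, intervalIntegral.integral_add (hII (by fun_prop)) (hII (by fun_prop)),
      intervalIntegral.integral_sub (hII (by fun_prop)) (hII (by fun_prop)),
      intervalIntegral.integral_const_mul, intervalIntegral.integral_const_mul, hmP]
    ring
  rw [hmP]
  have := mul_le_mul_of_nonneg_left hmain hPpos.le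
  rw [hSexp] at this
  linarith

section PrekopaLeindler

open scoped ENNReal

/-- The one-dimensional Brunn–Minkowski inequality. -/
lemma volume_add_le_of_convex_comb_mem {A B C : Set ℝ} (hA : MeasurableSet A)
    (hB : MeasurableSet B) (hAn : A.Nonempty) (hBn : B.Nonempty) {a b : ℝ}
    (ha : 0 < a) (hb : 0 < b) (h : ∀ x ∈ A, ∀ y ∈ B, a * x + b * y ∈ C) :
    ENNReal.ofReal a * volume A + ENNReal.ofReal b * volume B ≤ volume C := by
  have compact_case : ∀ K ⊆ A, IsCompact K → K.Nonempty → ∀ L ⊆ B, IsCompact L → L.Nonempty →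
      ENNReal.ofReal a * volume K + ENNReal.ofReal b * volume L ≤ volume C := by
    intro K hKA hK hKn L hLB hL hLn
    obtain ⟨x₀, hx₀, hx₀m⟩ := hK.exists_isGreatest hKn
    obtain ⟨y₀, hy₀, hy₀m⟩ := hL.exists_isLeast hLn
    have hKv : volume ((fun x => x + b * y₀) '' ((fun x => a * x) '' K)) =
        ENNReal.ofReal a * volume K := by
      rw [Set.image_add_right, measure_preimage_add_right]
      have := Measure.addHaar_image_homothety (volume : Measure ℝ) 0 a K
      have h2 : (fun x => a * x) '' K = (AffineMap.homothety (0 : ℝ) a) '' K := by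
        apply Set.image_congr
        intro x _
        simp [AffineMap.homothety_apply]
      rw [h2, this]
      simp [abs_of_pos ha]
    have hLv : volume ((fun x => x + a * x₀) '' ((fun x => b * x) '' L)) =
        ENNReal.ofReal b * volume L := by
      rw [Set.image_add_right, measure_preimage_add_right]
      have := Measure.addHaar_image_homothety (volume : Measure ℝ) 0 b L
      have h2 : (fun x => b * x) '' L = (AffineMap.homothety (0 : ℝ) b) '' L := by
        apply Set.image_congr
        intro x _
        simp [AffineMap.homothety_apply]
      rw [h2, this]
      simp [abs_of_pos hb]
    have hLm : MeasurableSet ((fun x => x + a * x₀) '' ((fun x => b * x) '' L)) :=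
      ((hL.image (by fun_prop)).image (by fun_prop)).measurableSet
    rw [← hKv, ← hLv, ← measure_union₀ hLm.nullMeasurableSet]
    · apply measure_mono
      rintro z (⟨_, ⟨x, hx, rfl⟩, rfl⟩ | ⟨_, ⟨y, hy, rfl⟩, rfl⟩)
      · exact h x (hKA hx) y₀ (hLB hy₀)
      · have := h x₀ (hKA hx₀) y (hLB hy)
        simpa [add_comm] using this
    · refine measure_mono_null (t := {a * x₀ + b * y₀}) ?_ (by simp)
      rintro z ⟨⟨_, ⟨x, hx, rfl⟩, rfl⟩, ⟨_, ⟨y, hy, rfl⟩, hz⟩⟩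
      have h1 := hx₀m hx
      have h2 := hy₀m hy
      simp only [Set.mem_singleton_iff] at hz ⊢
      nlinarith
  obtain ⟨x₁, hx₁⟩ := hAn
  obtain ⟨y₁, hy₁⟩ := hBn
  rw [hA.measure_eq_iSup_isCompact, hB.measure_eq_iSup_isCompact]
  simp only [ENNReal.mul_iSup]
  simp only [iSup_and']
  refine ENNReal.biSup_add_biSup_le' (p := fun K => K ⊆ A ∧ IsCompact K)
    (q := fun L => L ⊆ B ∧ IsCompact L) ⟨∅, by simp⟩ ⟨∅, by simp⟩ ?_
  rintro K ⟨hKA, hK⟩ L ⟨hLB, hL⟩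
  refine le_trans ?_ (compact_case (insert x₁ K) (Set.insert_subset hx₁ hKA) (hK.insert x₁)
    (Set.insert_nonempty _ _) (insert y₁ L) (Set.insert_subset hy₁ hLB) (hL.insert y₁)
    (Set.insert_nonempty _ _))
  gcongr <;> exact Set.subset_insert _ _

lemma ENNReal.rpow_mul_rpow_le_add {a b : ℝ} (ha : 0 < a) (hb : 0 < b) (hab : a + b = 1)
    (x y : ℝ≥0∞) : x ^ a * y ^ b ≤ ENNReal.ofReal a * x + ENNReal.ofReal b * y := by
  have ha' : ENNReal.ofReal a ≠ 0 := by simpa using ha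
  have hb' : ENNReal.ofReal b ≠ 0 := by simpa using hb
  rcases eq_or_ne x ∞ with rfl | hx
  · simp [ENNReal.mul_top ha']
  rcases eq_or_ne y ∞ with rfl | hy
  · simp [ENNReal.mul_top hb']
  have hx' := ENNReal.ofReal_toReal hx
  have hy' := ENNReal.ofReal_toReal hy
  rw [← hx', ← hy', ENNReal.ofReal_rpow_of_nonneg ENNReal.toReal_nonneg ha.le,
    ENNReal.ofReal_rpow_of_nonneg ENNReal.toReal_nonneg hb.le,
    ← ENNReal.ofReal_mul (by positivity), ← ENNReal.ofReal_mul ha.le, ← ENNReal.ofReal_mul hb.le,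
    ← ENNReal.ofReal_add (by positivity) (by positivity)]
  exact ENNReal.ofReal_le_ofReal (Real.geom_mean_le_arith_mean2_weighted ha.le hb.le
    ENNReal.toReal_nonneg ENNReal.toReal_nonneg hab)

/-- The additive form of the one-dimensional Prékopa–Leindler inequality, for functions
with values in `[0, 1]` that come arbitrarily close to `1`. -/
lemma lintegral_add_le_of_superlevel {f g h : ℝ → ℝ} (hfm : Measurable f) (hgm : Measurable g)
    (hhm : Measurable h) (hf0 : ∀ x, 0 ≤ f x) (hg0 : ∀ x, 0 ≤ g x) (hh0 : ∀ x, 0 ≤ h x)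
    (hf1 : ∀ x, f x ≤ 1) (hg1 : ∀ x, g x ≤ 1) (hfs : ∀ t < 1, ∃ x, t < f x)
    (hgs : ∀ t < 1, ∃ x, t < g x) {a b : ℝ} (ha : 0 < a) (hb : 0 < b)
    (H : ∀ x y t, 0 < t → t < f x → t < g y → t < h (a * x + b * y)) :
    ENNReal.ofReal a * (∫⁻ x, ENNReal.ofReal (f x)) +
        ENNReal.ofReal b * (∫⁻ x, ENNReal.ofReal (g x))
      ≤ ∫⁻ x, ENNReal.ofReal (h x) := by
  have meas : ∀ f : ℝ → ℝ, Measurable fun t => (volume {x | t < f x} : ℝ≥0∞) := by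
    intro f
    apply Antitone.measurable
    intro s t hst
    exact measure_mono fun x hx => lt_of_le_of_lt hst hx
  rw [lintegral_eq_lintegral_meas_lt volume (.of_forall hf0) hfm.aemeasurable,
    lintegral_eq_lintegral_meas_lt volume (.of_forall hg0) hgm.aemeasurable,
    lintegral_eq_lintegral_meas_lt volume (.of_forall hh0) hhm.aemeasurable,
    ← lintegral_const_mul _ (meas f), ← lintegral_const_mul _ (meas g),
    ← lintegral_add_left ((meas f).const_mul _)]
  apply setLIntegral_mono (meas h)
  intro t ht
  rcases lt_or_ge t 1 with h1 | h1
  · exact volume_add_le_of_convex_comb_mem (measurableSet_lt measurable_const hfm)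
      (measurableSet_lt measurable_const hgm) (hfs t h1) (hgs t h1) ha hb
      fun x hx y hy => H x y t ht hx hy
  · have e1 : {x | t < f x} = ∅ := by
      ext x; simpa using (hf1 x).trans h1
    have e2 : {x | t < g x} = ∅ := by
      ext x; simpa using (hg1 x).trans h1
    simp [e1, e2]

/-- The Prékopa–Leindler inequality holds on `E` for the volume measure. -/
def PrekopaLeindler (E : Type*) [AddCommGroup E] [Module ℝ E] [MeasureSpace E] : Prop :=
  ∀ ⦃a b : ℝ⦄, 0 < a → 0 < b → a + b = 1 → ∀ ⦃f g h : E → ℝ≥0∞⦄, Measurable f → Measurable g →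
    Measurable h → (∀ x y, f x ^ a * g y ^ b ≤ h (a • x + b • y)) →
    (∫⁻ x, f x) ^ a * (∫⁻ x, g x) ^ b ≤ ∫⁻ x, h x

lemma prekopaLeindler_real_of_bounded {a b : ℝ} (ha : 0 < a) (hb : 0 < b) (hab : a + b = 1)
    {f g h : ℝ → ℝ≥0∞} (hfm : Measurable f) (hgm : Measurable g) (hhm : Measurable h)
    (H : ∀ x y, f x ^ a * g y ^ b ≤ h (a * x + b * y))
    (hf : ⨆ x, f x ≠ ∞) (hg : ⨆ x, g x ≠ ∞) :
    (∫⁻ x, f x) ^ a * (∫⁻ x, g x) ^ b ≤ ∫⁻ x, h x := by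
  set S := ⨆ x, f x with hS
  set T := ⨆ x, g x with hT
  have hfS : ∀ x, f x ≤ S := le_iSup f
  have hgT : ∀ x, g x ≤ T := le_iSup g
  rcases eq_or_ne S 0 with hS0 | hS0
  · have : ∀ x, f x = 0 := fun x => le_antisymm (hS0 ▸ hfS x) zero_le
    simp [this, ENNReal.zero_rpow_of_pos ha]
  rcases eq_or_ne T 0 with hT0 | hT0
  · have : ∀ x, g x = 0 := fun x => le_antisymm (hT0 ▸ hgT x) zero_le
    simp [this, ENNReal.zero_rpow_of_pos hb]
  set R := S ^ a * T ^ b with hR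
  have hR0 : R ≠ 0 := by simp [hR, ENNReal.rpow_eq_zero_iff, hS0, hT0, hf, hg]
  have hRt : R ≠ ∞ := ENNReal.mul_ne_top (ENNReal.rpow_ne_top_of_nonneg ha.le hf)
    (ENNReal.rpow_ne_top_of_nonneg hb.le hg)
  have hle1 : ∀ x, f x / S ≤ 1 := fun x => ENNReal.div_le_of_le_mul (by simpa using hfS x)
  have hle2 : ∀ x, g x / T ≤ 1 := fun x => ENNReal.div_le_of_le_mul (by simpa using hgT x)
  have ht1 : ∀ x, f x / S ≠ ∞ := fun x => ((hle1 x).trans_lt ENNReal.one_lt_top).ne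
  have ht2 : ∀ x, g x / T ≠ ∞ := fun x => ((hle2 x).trans_lt ENNReal.one_lt_top).ne
  have ht3 : ∀ x, min (h x / R) 1 ≠ ∞ := fun x =>
    ((min_le_right _ _).trans_lt ENNReal.one_lt_top).ne
  have sup_lt : ∀ {f : ℝ → ℝ≥0∞} {S : ℝ≥0∞}, S = ⨆ x, f x → S ≠ 0 → S ≠ ∞ →
      (∀ x, f x / S ≠ ∞) → ∀ t < (1 : ℝ), ∃ x, t < (f x / S).toReal := by
    intro f S hS hS0 hSt hft t ht
    have ht' : max t 0 < 1 := max_lt ht zero_lt_one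
    have : ENNReal.ofReal (max t 0) * S < ⨆ x, f x := by
      rw [← hS]
      calc ENNReal.ofReal (max t 0) * S < 1 * S := by
            apply (ENNReal.mul_lt_mul_iff_left hS0 hSt).2
            rwa [ENNReal.ofReal_lt_one]
        _ = S := one_mul S
    obtain ⟨x, hx⟩ := lt_iSup_iff.1 this
    refine ⟨x, (le_max_left t 0).trans_lt ?_⟩
    rw [← ENNReal.ofReal_lt_iff_lt_toReal (le_max_right t 0) (hft x)]
    exact (ENNReal.lt_div_iff_mul_lt (.inl hS0) (.inl hSt)).2 hx
  have hdiv : ∀ p q : ℝ≥0∞, (p / S) ^ a * (q / T) ^ b = p ^ a * q ^ b / R := by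
    intro p q
    rw [ENNReal.div_rpow_of_nonneg _ _ ha.le, ENNReal.div_rpow_of_nonneg _ _ hb.le, hR,
      ENNReal.mul_div_mul_comm]
    · exact .inr (ENNReal.rpow_ne_top_of_nonneg hb.le hg)
    · exact .inl (ENNReal.rpow_ne_top_of_nonneg ha.le hf)
  have key := lintegral_add_le_of_superlevel (f := fun x => (f x / S).toReal)
    (g := fun x => (g x / T).toReal) (h := fun x => (min (h x / R) 1).toReal)
    (by fun_prop) (by fun_prop) (by fun_prop) (fun _ => ENNReal.toReal_nonneg)
    (fun _ => ENNReal.toReal_nonneg) (fun _ => ENNReal.toReal_nonneg)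
    (fun x => ENNReal.toReal_le_of_le_ofReal zero_le_one (by simpa using hle1 x))
    (fun x => ENNReal.toReal_le_of_le_ofReal zero_le_one (by simpa using hle2 x))
    (sup_lt hS hS0 hf ht1) (sup_lt hT hT0 hg ht2) ha hb (by
      intro x y t ht hx hy
      rw [← ENNReal.ofReal_lt_iff_lt_toReal ht.le (ht1 _)] at hx
      rw [← ENNReal.ofReal_lt_iff_lt_toReal ht.le (ht2 _)] at hy
      rw [← ENNReal.ofReal_lt_iff_lt_toReal ht.le (ht3 _)]
      refine lt_min ?_ (hx.trans_le (hle1 x))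
      calc ENNReal.ofReal t = ENNReal.ofReal t ^ a * ENNReal.ofReal t ^ b := by
            rw [← ENNReal.rpow_add_of_nonneg _ _ ha.le hb.le, hab, ENNReal.rpow_one]
        _ < (f x / S) ^ a * (g y / T) ^ b := by
            apply ENNReal.mul_lt_mul
            · exact ENNReal.rpow_lt_rpow hx ha
            · exact ENNReal.rpow_lt_rpow hy hb
        _ = f x ^ a * g y ^ b / R := hdiv _ _
        _ ≤ h (a * x + b * y) / R := ENNReal.div_le_div_right (H x y) R)
  simp only [ENNReal.ofReal_toReal (ht1 _), ENNReal.ofReal_toReal (ht2 _),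
    ENNReal.ofReal_toReal (ht3 _)] at key
  have h1 := (ENNReal.rpow_mul_rpow_le_add ha hb hab (∫⁻ x, f x / S) (∫⁻ x, g x / T)).trans key
  have h2 : ∫⁻ x, min (h x / R) 1 ≤ (∫⁻ x, h x) / R := by
    simp only [div_eq_mul_inv]
    rw [← lintegral_mul_const _ hhm]
    exact lintegral_mono fun x => min_le_left _ _
  have h3 := h1.trans h2
  simp only [div_eq_mul_inv _ S, div_eq_mul_inv _ T] at h3
  rw [lintegral_mul_const _ hfm, lintegral_mul_const _ hgm, ← div_eq_mul_inv, ← div_eq_mul_inv,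
    hdiv, ENNReal.div_le_iff hR0 hRt, ENNReal.div_mul_cancel hR0 hRt] at h3
  exact h3

lemma prekopaLeindler_real : PrekopaLeindler ℝ := by
  intro a b ha hb hab f g h hfm hgm hhm H
  have trunc : ∀ {f : ℝ → ℝ≥0∞}, Measurable f →
      ∫⁻ x, f x = ⨆ n : ℕ, ∫⁻ x, min (f x) n := by
    intro f hf
    rw [← lintegral_iSup (fun n => by fun_prop)]
    · congr with x
      rw [← inf_iSup_eq, ENNReal.iSup_natCast, inf_top_eq]
    · intro m n hmn x
      simp only
      gcongr
  have map_iSup : ∀ {c : ℝ} (_ : 0 < c) (u : ℕ → ℝ≥0∞), (⨆ n, u n) ^ c = ⨆ n, u n ^ c :=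
    fun hc u => (ENNReal.orderIsoRpow _ hc).map_iSup u
  rw [trunc hfm, trunc hgm, map_iSup ha, map_iSup hb, ENNReal.iSup_mul]
  refine iSup_le fun m => ?_
  rw [ENNReal.mul_iSup]
  refine iSup_le fun n => ?_
  apply prekopaLeindler_real_of_bounded ha hb hab (by fun_prop) (by fun_prop) hhm
  · intro x y
    refine le_trans ?_ (H x y)
    gcongr <;> exact min_le_left _ _
  · exact ((iSup_le fun x => min_le_right _ _).trans_lt (ENNReal.natCast_lt_top m)).ne
  · exact ((iSup_le fun x => min_le_right _ _).trans_lt (ENNReal.natCast_lt_top n)).ne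

lemma PrekopaLeindler.prod {E F : Type*} [AddCommGroup E] [Module ℝ E] [MeasureSpace E]
    [AddCommGroup F] [Module ℝ F] [MeasureSpace F] [SFinite (volume : Measure F)]
    (hE : PrekopaLeindler E) (hF : PrekopaLeindler F) : PrekopaLeindler (E × F) := by
  intro a b ha hb hab f g h hfm hgm hhm H
  rw [Measure.volume_eq_prod, lintegral_prod _ hfm.aemeasurable, lintegral_prod _ hgm.aemeasurable,
    lintegral_prod _ hhm.aemeasurable]
  apply hE ha hb hab hfm.lintegral_prod_right' hgm.lintegral_prod_right' hhm.lintegral_prod_right'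
  intro x y
  apply hF ha hb hab (by fun_prop) (by fun_prop) (by fun_prop)
  intro z w
  exact H (x, z) (y, w)

lemma PrekopaLeindler.of_measurePreserving {E F : Type*} [AddCommGroup E] [Module ℝ E]
    [MeasureSpace E] [AddCommGroup F] [Module ℝ F] [MeasureSpace F] (hE : PrekopaLeindler E)
    (e : E ≃ᵐ F) (he : MeasurePreserving e)
    (hlin : ∀ (a b : ℝ) (x y : E), e (a • x + b • y) = a • e x + b • e y) :
    PrekopaLeindler F := by
  intro a b ha hb hab f g h hfm hgm hhm H
  rw [← he.lintegral_comp hfm, ← he.lintegral_comp hgm, ← he.lintegral_comp hhm]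
  apply hE ha hb hab (hfm.comp e.measurable) (hgm.comp e.measurable) (hhm.comp e.measurable)
  intro x y
  simpa [hlin] using H (e x) (e y)

lemma prekopaLeindler_pi (m : ℕ) : PrekopaLeindler (Fin m → ℝ) := by
  induction m with
  | zero =>
    intro a b ha hb hab f g h hfm hgm hhm H
    have hH := H default default
    rw [Subsingleton.elim (a • default + b • default) (default : Fin 0 → ℝ)] at hH
    rw [Measure.volume_pi_eq_dirac default]
    simpa [lintegral_dirac' _ hfm, lintegral_dirac' _ hgm, lintegral_dirac' _ hhm] using hH
  | succ m ih =>
    refine (prekopaLeindler_real.prod ih).of_measurePreserving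
      (MeasurableEquiv.piFinSuccAbove (fun _ => ℝ) 0).symm
      ((volume_preserving_piFinSuccAbove (fun _ => ℝ) 0).symm _) ?_
    intro a b x y
    ext i
    refine Fin.cases ?_ (fun j => ?_) i <;> simp [MeasurableEquiv.piFinSuccAbove]

/-- The Prékopa–Leindler inequality on Euclidean space. -/
lemma prekopaLeindler_euclideanSpace (n : ℕ) : PrekopaLeindler (EuclideanSpace ℝ (Fin n)) :=
  (prekopaLeindler_pi n).of_measurePreserving (MeasurableEquiv.toLp 2 (Fin n → ℝ))
    (PiLp.volume_preserving_toLp (Fin n)) fun a b x y => by ext; simp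

end PrekopaLeindler

section Marginal

variable {n : ℕ} {K : Set (EuclideanSpace ℝ (Fin n))} {φ : EuclideanSpace ℝ (Fin n) →L[ℝ] ℝ}

lemma exists_bound_of_isBounded (φ : EuclideanSpace ℝ (Fin n) →L[ℝ] ℝ)
    (hK : Bornology.IsBounded K) : ∃ M, ∀ x ∈ K, |φ x| ≤ M := by
  obtain ⟨R, hR⟩ := hK.exists_norm_le
  refine ⟨‖φ‖ * R, fun x hx => (φ.le_opNorm x).trans ?_⟩
  gcongr
  exact hR x hx

/-- The marginal of a convex set along `φ`, smoothed by a Gaussian. -/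
def gaussianMarginal (K : Set (EuclideanSpace ℝ (Fin n)))
    (φ : EuclideanSpace ℝ (Fin n) →L[ℝ] ℝ) (c t : ℝ) : ℝ :=
  ∫ x in K, exp (-(c * (t - φ x)) ^ 2)

lemma integrableOn_gaussian (hKb : Bornology.IsBounded K) (c t : ℝ) :
    IntegrableOn (fun x => exp (-(c * (t - φ x)) ^ 2)) K := by
  have : IsFiniteMeasure (volume.restrict K) := ⟨by simpa using hKb.measure_lt_top⟩
  refine Integrable.mono' (integrable_const 1) (by fun_prop) (.of_forall fun x => ?_)
  rw [Real.norm_of_nonneg (exp_pos _).le]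
  exact Real.exp_le_one_iff.2 (by simp; positivity)

lemma gaussianMarginal_pos (hKb : Bornology.IsBounded K) (hK0 : volume K ≠ 0) (c t : ℝ) :
    0 < gaussianMarginal K φ c t := by
  have : NeZero (volume.restrict K) := ⟨by simpa using hK0⟩
  exact integral_exp_pos (μ := volume.restrict K) (integrableOn_gaussian hKb c t)

lemma analyticAt_gaussianMarginal (hKm : MeasurableSet K) (hKb : Bornology.IsBounded K) (c t : ℝ) :
    AnalyticAt ℝ (gaussianMarginal K φ c) t := by
  have : IsFiniteMeasure (volume.restrict K) := ⟨by simpa using hKb.measure_lt_top⟩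
  set ν := (volume.restrict K).withDensity fun x => ENNReal.ofReal (exp (-(c * φ x) ^ 2)) with hν
  have hm : Measurable fun x => ENNReal.ofReal (exp (-(c * φ x) ^ 2)) := by fun_prop
  have hset : ∀ s, s ∈ ProbabilityTheory.integrableExpSet φ ν := by
    intro s
    change Integrable _ _
    rw [hν, integrable_withDensity_iff_integrable_smul' hm (by simp)]
    obtain ⟨M, hM⟩ := exists_bound_of_isBounded φ hKb
    refine Integrable.mono' (integrable_const (exp (|s| * M))) (by fun_prop) ?_
    filter_upwards [ae_restrict_mem hKm] with x hx
    rw [ENNReal.toReal_ofReal (exp_pos _).le, smul_eq_mul, ← Real.exp_add,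
      Real.norm_of_nonneg (exp_pos _).le]
    apply Real.exp_le_exp.2
    have h1 : s * φ x ≤ |s| * M :=
      (le_abs_self _).trans (by rw [abs_mul]; gcongr; exact hM x hx)
    have h2 := sq_nonneg (c * φ x)
    linarith
  have heq : gaussianMarginal K φ c =
      fun t => exp (-(c * t) ^ 2) * ProbabilityTheory.mgf φ ν (2 * c ^ 2 * t) := by
    ext t
    rw [ProbabilityTheory.mgf, hν, integral_withDensity_eq_integral_toReal_smul hm (by simp),
      ← integral_const_mul]
    apply integral_congr_ae (.of_forall fun x => ?_)
    rw [ENNReal.toReal_ofReal (exp_pos _).le, smul_eq_mul, ← Real.exp_add, ← Real.exp_add]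
    congr 1
    ring
  have hint : (2 * c ^ 2 * t) ∈ interior (ProbabilityTheory.integrableExpSet φ ν) := by
    rw [Set.eq_univ_of_forall hset]; simp
  rw [heq]
  have h1 : AnalyticAt ℝ (fun t : ℝ => 2 * c ^ 2 * t) t := by fun_prop
  have h2 := (ProbabilityTheory.analyticAt_mgf hint).comp_of_eq h1 rfl
  have h3 : AnalyticAt ℝ (fun t : ℝ => exp (-(c * t) ^ 2)) t := by fun_prop
  exact h3.mul h2

lemma gaussianMarginal_logConcave (hKm : MeasurableSet K) (hKb : Bornology.IsBounded K)
    (hKc : Convex ℝ K) (c : ℝ) {a b : ℝ} (ha : 0 < a) (hb : 0 < b) (hab : a + b = 1) (s r : ℝ) :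
    gaussianMarginal K φ c s ^ a * gaussianMarginal K φ c r ^ b ≤
      gaussianMarginal K φ c (a * s + b * r) := by
  set w : ℝ → EuclideanSpace ℝ (Fin n) → ENNReal :=
    fun t => K.indicator fun x => ENNReal.ofReal (exp (-(c * (t - φ x)) ^ 2)) with hw
  have hwm : ∀ t, Measurable (w t) := fun t => Measurable.indicator (by fun_prop) hKm
  have hwp : ∀ t, ∫⁻ x, w t x = ENNReal.ofReal (gaussianMarginal K φ c t) := by
    intro t
    rw [hw, lintegral_indicator hKm, gaussianMarginal,
      ofReal_integral_eq_lintegral_ofReal (integrableOn_gaussian hKb c t)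
        (.of_forall fun x => (exp_pos _).le)]
  have hp0 : ∀ t, 0 ≤ gaussianMarginal K φ c t := fun t => integral_nonneg fun x => (exp_pos _).le
  have key := prekopaLeindler_euclideanSpace n ha hb hab (hwm s) (hwm r) (hwm (a * s + b * r)) (by
    intro x y
    by_cases hx : x ∈ K
    · by_cases hy : y ∈ K
      · simp only [hw, Set.indicator_of_mem hx, Set.indicator_of_mem hy,
          Set.indicator_of_mem (hKc hx hy ha.le hb.le hab)]
        rw [ENNReal.ofReal_rpow_of_nonneg (exp_pos _).le ha.le,
          ENNReal.ofReal_rpow_of_nonneg (exp_pos _).le hb.le,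
          ← ENNReal.ofReal_mul (by positivity), ← Real.exp_mul, ← Real.exp_mul, ← Real.exp_add]
        apply ENNReal.ofReal_le_ofReal
        apply Real.exp_le_exp.2
        rw [map_add, map_smul, map_smul, smul_eq_mul, smul_eq_mul]
        obtain rfl : b = 1 - a := by linarith
        nlinarith [mul_nonneg (mul_pos ha hb).le (sq_nonneg (c * (s - φ x) - c * (r - φ y)))]
      · simp [hw, Set.indicator_of_notMem hy, ENNReal.zero_rpow_of_pos hb]
    · simp [hw, Set.indicator_of_notMem hx, ENNReal.zero_rpow_of_pos ha])
  rw [hwp, hwp, hwp, ENNReal.ofReal_rpow_of_nonneg (hp0 _) ha.le,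
    ENNReal.ofReal_rpow_of_nonneg (hp0 _) hb.le,
    ← ENNReal.ofReal_mul (Real.rpow_nonneg (hp0 _) _)] at key
  exact (ENNReal.ofReal_le_ofReal_iff (hp0 _)).1 key

lemma exists_potential_gaussianMarginal (hKm : MeasurableSet K) (hKb : Bornology.IsBounded K)
    (hKc : Convex ℝ K) (hK0 : volume K ≠ 0) (c : ℝ) :
    ∃ V V₁ V₂ : ℝ → ℝ, (∀ x, HasDerivAt V (V₁ x) x) ∧ (∀ x, HasDerivAt V₁ (V₂ x) x) ∧
      (∀ x, 0 ≤ V₂ x) ∧ ∀ t, exp (-V t) = gaussianMarginal K φ c t := by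
  have hpos := gaussianMarginal_pos (φ := φ) hKb hK0 c
  set V : ℝ → ℝ := fun t => -log (gaussianMarginal K φ c t) with hV
  have hVa : ∀ t, AnalyticAt ℝ V t := fun t =>
    ((analyticAt_gaussianMarginal hKm hKb c t).log (hpos t)).neg
  have hVd : Differentiable ℝ V := fun t => (hVa t).differentiableAt
  have hVd1 : Differentiable ℝ (deriv V) := fun t => (hVa t).deriv.differentiableAt
  have hconv : ConvexOn ℝ Set.univ V := by
    refine convexOn_iff_forall_pos.2 ⟨convex_univ, fun s _ r _ a b ha hb hab => ?_⟩
    have h := Real.log_le_log (by have := hpos s; have := hpos r; positivity)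
      (gaussianMarginal_logConcave (φ := φ) hKm hKb hKc c ha hb hab s r)
    rw [Real.log_mul (Real.rpow_pos_of_pos (hpos s) _).ne' (Real.rpow_pos_of_pos (hpos r) _).ne',
      Real.log_rpow (hpos s), Real.log_rpow (hpos r)] at h
    simp only [hV, smul_eq_mul]
    linarith
  refine ⟨V, deriv V, deriv (deriv V), fun x => (hVd x).hasDerivAt, fun x => (hVd1 x).hasDerivAt,
    fun x => ?_, fun t => ?_⟩
  · have hmono : Monotone (deriv V) := by
      rw [← monotoneOn_univ]
      exact hconv.monotoneOn_deriv fun x _ => hVd x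
    exact hmono.deriv_nonneg
  · simp [hV, Real.exp_log (hpos t)]

end Marginal

section Limit

variable {n : ℕ} {K : Set (EuclideanSpace ℝ (Fin n))} {φ : EuclideanSpace ℝ (Fin n) →L[ℝ] ℝ}

lemma integral_shifted_gaussian {c : ℝ} (hc : 0 < c) (s : ℝ) :
    ∫ t : ℝ, exp (-(c * (t - s)) ^ 2) * (c / √π) = 1 := by
  rw [integral_mul_const, integral_sub_right_eq_self (fun t => exp (-(c * t) ^ 2)) s]
  have : ∀ t : ℝ, -(c * t) ^ 2 = -c ^ 2 * t ^ 2 := fun t => by ring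
  simp_rw [this]
  rw [integral_gaussian, Real.sqrt_div pi_pos.le, Real.sqrt_sq hc.le]
  have : √π ≠ 0 := by positivity
  field_simp

lemma integrable_shifted_gaussian {c : ℝ} (hc : 0 < c) (s : ℝ) :
    Integrable fun t : ℝ => exp (-(c * (t - s)) ^ 2) * (c / √π) :=
  integrable_of_integral_eq_one (integral_shifted_gaussian hc s)

lemma tendsto_gaussian_integral {A B : ℝ} {ψ : ℝ → ℝ} (hψ : ContinuousOn ψ (Set.Icc A B)) {s : ℝ}
    (hs : s ∈ Set.Ioo A B) :
    Filter.Tendsto (fun c : ℝ => ∫ t in Set.Icc A B, ψ t * (exp (-(c * (t - s)) ^ 2) * (c / √π)))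
      Filter.atTop (nhds (ψ s)) := by
  have hcont : ContinuousAt ((Set.Icc A B).indicator ψ) s := by
    refine (hψ.continuousAt (Icc_mem_nhds hs.1 hs.2)).congr ?_
    filter_upwards [Icc_mem_nhds hs.1 hs.2] with t ht
    rw [Set.indicator_of_mem ht]
  have h := tendsto_integral_comp_smul_smul_of_integrable' (μ := (volume : Measure ℝ))
    (φ := fun t : ℝ => exp (-t ^ 2) / √π) (fun t => by positivity) (by
      have := integral_shifted_gaussian one_pos 0
      simpa [div_eq_mul_inv] using this) (by
      have := (tendsto_rpow_abs_mul_exp_neg_mul_sq_cocompact one_pos 1).div_const √π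
      simp only [Module.finrank_self, pow_one, Metric.cobounded_eq_cocompact]
      simpa [mul_div_assoc] using this)
    (hψ.integrableOn_Icc.integrable_indicator measurableSet_Icc) hcont
  rw [Set.indicator_of_mem (Set.Ioo_subset_Icc_self hs)] at h
  refine h.congr fun c => ?_
  rw [← integral_indicator measurableSet_Icc]
  apply integral_congr_ae (.of_forall fun t => ?_)
  by_cases ht : t ∈ Set.Icc A B
  · simp only [Set.indicator_of_mem ht, Module.finrank_self, smul_eq_mul]
    rw [show (c * (s - t)) ^ 2 = (c * (t - s)) ^ 2 by ring]
    ring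
  · simp [Set.indicator_of_notMem ht]

lemma tendsto_integral_mul_gaussianMarginal (hKm : MeasurableSet K) (hKb : Bornology.IsBounded K)
    {A B : ℝ} (hAB : A < B) (hφ : ∀ x ∈ K, φ x ∈ Set.Ioo A B) {ψ : ℝ → ℝ}
    (hψ : ContinuousOn ψ (Set.Icc A B)) :
    Filter.Tendsto (fun c : ℝ => (c / √π) * ∫ t in A..B, ψ t * gaussianMarginal K φ c t)
      Filter.atTop (nhds (∫ x in K, ψ (φ x))) := by
  have : IsFiniteMeasure (volume.restrict K) := ⟨by simpa using hKb.measure_lt_top⟩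
  obtain ⟨M, hM⟩ := isCompact_Icc.exists_bound_of_continuousOn hψ
  have hM0 : 0 ≤ M := (norm_nonneg _).trans (hM A ⟨le_rfl, hAB.le⟩)
  have hint : ∀ c, Integrable
      (fun z : ℝ × EuclideanSpace ℝ (Fin n) => ψ z.1 * (exp (-(c * (z.1 - φ z.2)) ^ 2) * (c / √π)))
      ((volume.restrict (Set.Icc A B)).prod (volume.restrict K)) := by
    intro c
    refine Integrable.mul_bdd (c := |c / √π|) (hψ.integrableOn_Icc.integrable.comp_fst _)
      (by fun_prop) (.of_forall fun z => ?_)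
    rw [norm_mul, Real.norm_of_nonneg (exp_pos _).le, Real.norm_eq_abs]
    exact mul_le_of_le_one_left (abs_nonneg _) (Real.exp_le_one_iff.2 (by simp; positivity))
  have heq : ∀ c : ℝ, (c / √π) * ∫ t in A..B, ψ t * gaussianMarginal K φ c t =
      ∫ x in K, ∫ t in Set.Icc A B, ψ t * (exp (-(c * (t - φ x)) ^ 2) * (c / √π)) := by
    intro c
    rw [← integral_integral_swap (f := fun t x => ψ t * (exp (-(c * (t - φ x)) ^ 2) * (c / √π)))
        (hint c), intervalIntegral.integral_of_le hAB.le, ← integral_Icc_eq_integral_Ioc,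
      ← integral_const_mul]
    apply integral_congr_ae (.of_forall fun t => ?_)
    simp only [gaussianMarginal]
    rw [integral_const_mul, integral_mul_const]
    ring
  simp_rw [heq]
  refine tendsto_integral_filter_of_dominated_convergence (fun _ => M) ?_ ?_
    (integrable_const _) ?_
  · exact .of_forall fun c => (hint c).integral_prod_right.aestronglyMeasurable
  · filter_upwards [Filter.eventually_gt_atTop 0] with c hc
    refine .of_forall fun x => ?_
    have hi := integrable_shifted_gaussian hc (φ x)
    calc ‖∫ t in Set.Icc A B, ψ t * (exp (-(c * (t - φ x)) ^ 2) * (c / √π))‖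
        ≤ ∫ t in Set.Icc A B, M * (exp (-(c * (t - φ x)) ^ 2) * (c / √π)) := by
          refine norm_integral_le_of_norm_le (hi.const_mul M).integrableOn ?_
          filter_upwards [ae_restrict_mem measurableSet_Icc] with t ht
          rw [norm_mul, Real.norm_of_nonneg (r := exp _ * _) (by positivity)]
          gcongr
          exact hM t ht
      _ ≤ ∫ t, M * (exp (-(c * (t - φ x)) ^ 2) * (c / √π)) :=
          setIntegral_le_integral (hi.const_mul M) (.of_forall fun t => by positivity)
      _ = M := by rw [integral_const_mul, integral_shifted_gaussian hc, mul_one]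
  · filter_upwards [ae_restrict_mem hKm] with x hx
    exact tendsto_gaussian_integral hψ (hφ x hx)

/-- The Payne–Weinberger inequality for functions of one linear coordinate on a convex set. -/
lemma poincare_marginal (hKm : MeasurableSet K) (hKb : Bornology.IsBounded K)
    (hKc : Convex ℝ K) (hK0 : volume K ≠ 0) {A B : ℝ} (hAB : A < B)
    (hφ : ∀ x ∈ K, φ x ∈ Set.Ioo A B) {f f' : ℝ → ℝ} (hfc : ContinuousOn f (Set.Icc A B))
    (hf : ∀ x ∈ Set.Ioo A B, HasDerivAt f (f' x) x) (hf'c : ContinuousOn f' (Set.Icc A B)) :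
    volume.real K * (∫ x in K, f (φ x) ^ 2) - (∫ x in K, f (φ x)) ^ 2 ≤
      ((B - A) / π) ^ 2 * (volume.real K * ∫ x in K, f' (φ x) ^ 2) := by
  have h1 := tendsto_integral_mul_gaussianMarginal hKm hKb hAB hφ
    (ψ := fun _ => 1) continuousOn_const
  have h2 := tendsto_integral_mul_gaussianMarginal hKm hKb hAB hφ (ψ := fun t => f t ^ 2)
    (by fun_prop)
  have h3 := tendsto_integral_mul_gaussianMarginal hKm hKb hAB hφ hfc
  have h4 := tendsto_integral_mul_gaussianMarginal hKm hKb hAB hφ (ψ := fun t => f' t ^ 2)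
    (by fun_prop)
  have hK1 : ∫ _ in K, (1 : ℝ) = volume.real K := by simp
  rw [hK1] at h1
  refine le_of_tendsto_of_tendsto' ((h1.mul h2).sub (h3.pow 2)) ((h1.mul h4).const_mul _) ?_
  intro c
  obtain ⟨V, V₁, V₂, hV, hV₁, hV₂, hVp⟩ :=
    exists_potential_gaussianMarginal (φ := φ) hKm hKb hKc hK0 c
  have key := poincare_interval_of_convex hAB hV hV₁ hV₂ hfc hf hf'c
  simp only [hVp] at key
  simp only [one_mul]
  have := mul_le_mul_of_nonneg_left key (sq_nonneg (c / √π))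
  linarith

end Limit

section Bisection

variable {n : ℕ} {K : Set (EuclideanSpace ℝ (Fin n))}

/-- The affine function `α (x i - r) + β (x j - s)`. -/
def planarForm (i j : Fin n) (r s α β : ℝ) (x : EuclideanSpace ℝ (Fin n)) : ℝ :=
  α * (x i - r) + β * (x j - s)

lemma continuous_planarForm (i j : Fin n) (r s α β : ℝ) :
    Continuous (planarForm i j r s α β) := by
  unfold planarForm
  fun_prop

lemma volume_planarForm_eq_zero {i j : Fin n} (hij : i ≠ j) (r s : ℝ) {α β : ℝ}
    (h : α ≠ 0 ∨ β ≠ 0) : volume {x | planarForm i j r s α β x = 0} = 0 := by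
  set φ : EuclideanSpace ℝ (Fin n) →ₗ[ℝ] ℝ :=
    α • (EuclideanSpace.proj i : EuclideanSpace ℝ (Fin n) →L[ℝ] ℝ).toLinearMap +
      β • (EuclideanSpace.proj j : EuclideanSpace ℝ (Fin n) →L[ℝ] ℝ).toLinearMap with hφ
  have hφx : ∀ x, φ x = α * x i + β * x j := fun x => by simp [hφ]
  have hker : LinearMap.ker φ ≠ ⊤ := by
    intro htop
    have hz : ∀ x, φ x = 0 := fun x => by
      have : x ∈ LinearMap.ker φ := htop ▸ Submodule.mem_top
      simpa using this
    have h1 := hz (EuclideanSpace.single i 1)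
    have h2 := hz (EuclideanSpace.single j 1)
    rw [hφx] at h1 h2
    simp [hij, hij.symm] at h1 h2
    tauto
  set x₀ : EuclideanSpace ℝ (Fin n) := r • EuclideanSpace.single i 1 + s • EuclideanSpace.single j 1
  have hset : {x | planarForm i j r s α β x = 0} = (fun x => x - x₀) ⁻¹' (LinearMap.ker φ) := by
    ext x
    simp [hφx, planarForm, x₀, hij, hij.symm]
  rw [hset]
  simp_rw [sub_eq_add_neg]
  rw [measure_preimage_add_right]
  exact Measure.addHaar_submodule _ _ hker

lemma exists_bisecting_halfspace {u G : EuclideanSpace ℝ (Fin n) → ℝ}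
    (hu : IntegrableOn u K) (hG : IntegrableOn G K) (hu0 : ∫ x in K, u x = 0)
    (hG0 : ∫ x in K, G x < 0) {i j : Fin n} (hij : i ≠ j) (r s : ℝ) :
    ∃ α β : ℝ, (α ≠ 0 ∨ β ≠ 0) ∧ ∫ x in K ∩ {x | 0 ≤ planarForm i j r s α β x}, u x = 0 ∧
      ∫ x in K ∩ {x | 0 ≤ planarForm i j r s α β x}, G x < 0 := by
  have hne : ∀ θ : ℝ, cos θ ≠ 0 ∨ sin θ ≠ 0 := by
    intro θ
    by_contra! h
    have := sin_sq_add_cos_sq θ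
    rw [h.1, h.2] at this
    norm_num at this
  set H : ℝ → Set (EuclideanSpace ℝ (Fin n)) :=
    fun θ => {x | 0 ≤ planarForm i j r s (cos θ) (sin θ) x} with hH
  have hHm : ∀ θ, MeasurableSet (H θ) := fun θ =>
    measurableSet_le measurable_const (continuous_planarForm _ _ _ _ _ _).measurable
  have hnull : ∀ θ, ∀ᵐ x ∂(volume.restrict K), planarForm i j r s (cos θ) (sin θ) x ≠ 0 :=
    fun θ => ae_restrict_of_ae (measure_eq_zero_iff_ae_notMem.1
      (volume_planarForm_eq_zero hij r s (hne θ)))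
  set f : ℝ → ℝ := fun θ => ∫ x in K, (H θ).indicator u x with hf
  have hfeq : ∀ θ, f θ = ∫ x in K ∩ H θ, u x := fun θ => setIntegral_indicator (hHm θ)
  have hfc : Continuous f := by
    rw [continuous_iff_continuousAt]
    intro θ
    refine continuousAt_of_dominated (bound := fun x => ‖u x‖)
      (.of_forall fun η => hu.aestronglyMeasurable.indicator (hHm η))
      (.of_forall fun η => .of_forall fun x => norm_indicator_le_norm_self _ _) hu.norm ?_
    filter_upwards [hnull θ] with x hx
    have hcont : Continuous fun η => planarForm i j r s (cos η) (sin η) x := by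
      unfold planarForm
      fun_prop
    rcases lt_or_gt_of_ne hx with h | h
    · have : (fun η => (H η).indicator u x) =ᶠ[nhds θ] fun _ => 0 := by
        filter_upwards [hcont.continuousAt.eventually_lt continuousAt_const h] with η hη
        exact Set.indicator_of_notMem (by simpa [hH] using hη) _
      exact (continuousAt_congr this).2 continuousAt_const
    · have : (fun η => (H η).indicator u x) =ᶠ[nhds θ] fun _ => u x := by
        filter_upwards [continuousAt_const.eventually_lt hcont.continuousAt h] with η hη
        exact Set.indicator_of_mem (by simpa [hH] using hη.le) _
      exact (continuousAt_congr this).2 continuousAt_const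
  have hsplit : ∀ {w : EuclideanSpace ℝ (Fin n) → ℝ}, IntegrableOn w K → ∀ θ,
      (∫ x in K ∩ H θ, w x) + ∫ x in K ∩ H (θ + π), w x = ∫ x in K, w x := by
    intro w hw θ
    rw [← setIntegral_indicator (hHm θ), ← setIntegral_indicator (hHm (θ + π)),
      ← integral_add (hw.indicator (hHm _)) (hw.indicator (hHm _))]
    apply integral_congr_ae
    filter_upwards [hnull θ] with x hx
    have hneg : planarForm i j r s (cos (θ + π)) (sin (θ + π)) x =
        -planarForm i j r s (cos θ) (sin θ) x := by
      simp only [planarForm, cos_add_pi, sin_add_pi]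
      ring
    rcases lt_or_gt_of_ne hx with h | h
    · rw [Set.indicator_of_notMem (by simpa [hH] using h),
        Set.indicator_of_mem (by simp only [hH, Set.mem_ofPred_eq, hneg]; linarith), zero_add]
    · rw [Set.indicator_of_mem (by simpa [hH] using h.le),
        Set.indicator_of_notMem (by simp only [hH, Set.mem_ofPred_eq, hneg]; linarith), add_zero]
  obtain ⟨θ, hθ⟩ : ∃ θ, f θ = 0 := by
    have h0 : f 0 + f π = 0 := by
      have := hsplit hu 0
      rwa [zero_add, hu0, ← hfeq, ← hfeq] at this
    rcases le_total (f 0) 0 with h | h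
    · exact mem_range_of_exists_le_of_exists_ge hfc ⟨0, h⟩ ⟨π, by linarith⟩
    · exact mem_range_of_exists_le_of_exists_ge hfc ⟨π, by linarith⟩ ⟨0, h⟩
  have hGs := hsplit hG θ
  have hus := hsplit hu θ
  rw [hfeq] at hθ
  rcases lt_or_ge (∫ x in K ∩ H θ, G x) 0 with h | h
  · exact ⟨_, _, hne θ, hθ, h⟩
  · exact ⟨_, _, hne (θ + π), by linarith, by linarith⟩

lemma exists_rat_mem_triangle (a₁ a₂ : ℝ) {v₁ v₂ w₁ w₂ : ℝ} (hD : v₁ * w₂ - v₂ * w₁ ≠ 0) :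
    ∃ r s : ℚ, ∃ σ τ : ℝ, 0 < σ ∧ 0 < τ ∧ σ + τ < 1 ∧
      (r : ℝ) = a₁ + σ * v₁ + τ * w₁ ∧ (s : ℝ) = a₂ + σ * v₂ + τ * w₂ := by
  obtain ⟨D, hDd⟩ : ∃ D, D = v₁ * w₂ - v₂ * w₁ := ⟨_, rfl⟩
  rw [← hDd] at hD
  let S : ℝ × ℝ → ℝ := fun p => ((p.1 - a₁) * w₂ - (p.2 - a₂) * w₁) / D
  let T : ℝ × ℝ → ℝ := fun p => (v₁ * (p.2 - a₂) - v₂ * (p.1 - a₁)) / D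
  have hSc : Continuous S := by fun_prop
  have hTc : Continuous T := by fun_prop
  have hO : IsOpen {p : ℝ × ℝ | 0 < S p ∧ 0 < T p ∧ S p + T p < 1} :=
    (isOpen_lt continuous_const hSc).inter
      ((isOpen_lt continuous_const hTc).inter (isOpen_lt (hSc.add hTc) continuous_const))
  have hOn : {p : ℝ × ℝ | 0 < S p ∧ 0 < T p ∧ S p + T p < 1}.Nonempty := by
    refine ⟨(a₁ + (v₁ + w₁) / 3, a₂ + (v₂ + w₂) / 3), ?_⟩
    have e1 : S (a₁ + (v₁ + w₁) / 3, a₂ + (v₂ + w₂) / 3) = 1 / 3 := by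
      rw [div_eq_div_iff hD (by norm_num), hDd]
      ring
    have e2 : T (a₁ + (v₁ + w₁) / 3, a₂ + (v₂ + w₂) / 3) = 1 / 3 := by
      rw [div_eq_div_iff hD (by norm_num), hDd]
      ring
    rw [Set.mem_ofPred_eq, e1, e2]
    norm_num
  have hdense : DenseRange (Prod.map ((↑) : ℚ → ℝ) ((↑) : ℚ → ℝ)) :=
    Rat.denseRange_cast.prodMap Rat.denseRange_cast
  obtain ⟨⟨r, s⟩, h1, h2, h3⟩ := hdense.exists_mem_open hO hOn
  refine ⟨r, s, _, _, h1, h2, h3, ?_, ?_⟩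
  · simp only [S, T, Prod.map]
    field_simp
    rw [hDd]
    ring
  · simp only [S, T, Prod.map]
    field_simp
    rw [hDd]
    ring

lemma eq_zero_of_nonneg_on_triangle {v₁ v₂ w₁ w₂ : ℝ} (hD : v₁ * w₂ - v₂ * w₁ ≠ 0)
    {σ τ α β : ℝ} (hσ : 0 < σ) (hτ : 0 < τ) (hστ : σ + τ < 1)
    (h1 : σ * (α * v₁ + β * v₂) + τ * (α * w₁ + β * w₂) ≤ 0)
    (h2 : 0 ≤ (α * v₁ + β * v₂) - (σ * (α * v₁ + β * v₂) + τ * (α * w₁ + β * w₂)))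
    (h3 : 0 ≤ (α * w₁ + β * w₂) - (σ * (α * v₁ + β * v₂) + τ * (α * w₁ + β * w₂))) :
    α = 0 ∧ β = 0 := by
  obtain ⟨p, hp⟩ : ∃ p, p = α * v₁ + β * v₂ := ⟨_, rfl⟩
  obtain ⟨q, hq⟩ : ∃ q, q = α * w₁ + β * w₂ := ⟨_, rfl⟩
  rw [← hp, ← hq] at h1 h2 h3
  have hz : σ * p + τ * q = 0 := by
    have k1 := mul_nonneg hσ.le h2
    have k2 := mul_nonneg hτ.le h3
    have k3 : 0 ≤ (σ * p + τ * q) * (1 - (σ + τ)) := by linarith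
    exact le_antisymm h1 (nonneg_of_mul_nonneg_left k3 (by linarith))
  rw [hz, sub_zero] at h2 h3
  have k1 := mul_nonneg hσ.le h2
  have k2 := mul_nonneg hτ.le h3
  have hp0 : p = 0 := (mul_eq_zero.1 (by linarith : σ * p = 0)).resolve_left hσ.ne'
  have hq0 : q = 0 := (mul_eq_zero.1 (by linarith : τ * q = 0)).resolve_left hτ.ne'
  constructor
  · refine (mul_eq_zero.1 (?_ : α * (v₁ * w₂ - v₂ * w₁) = 0)).resolve_right hD
    linear_combination w₂ * (hp0 - hp) - v₂ * (hq0 - hq)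
  · refine (mul_eq_zero.1 (?_ : β * (v₁ * w₂ - v₂ * w₁) = 0)).resolve_right hD
    linear_combination v₁ * (hq0 - hq) - w₁ * (hp0 - hp)

lemma exists_subset_segment {X : Set (EuclideanSpace ℝ (Fin n))} (hX : IsCompact X)
    (hXn : X.Nonempty)
    (h : ∀ i j : Fin n, i ≠ j → ∀ r s : ℚ, ∃ α β : ℝ, (α ≠ 0 ∨ β ≠ 0) ∧
      ∀ x ∈ X, 0 ≤ planarForm i j r s α β x) :
    ∃ a ∈ X, ∃ b ∈ X, X ⊆ segment ℝ a b := by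
  obtain ⟨⟨a, b⟩, ⟨ha, hb⟩, hmax⟩ := (hX.prod hX).exists_isMaxOn (hXn.prod hXn)
    (f := fun p => ‖p.2 - p.1‖) (by fun_prop)
  have hmax : ∀ x ∈ X, ∀ y ∈ X, ‖y - x‖ ≤ ‖b - a‖ := fun x hx y hy => hmax (a := (x, y)) ⟨hx, hy⟩
  refine ⟨a, ha, b, hb, fun x hx => ?_⟩
  rcases eq_or_ne (b - a) 0 with hv | hv
  · have := hmax a ha x hx
    rw [hv, norm_zero, norm_le_zero_iff, sub_eq_zero] at this
    exact this ▸ left_mem_segment ℝ a b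
  set v := b - a with hv_def
  set w := x - a with hw_def
  obtain ⟨i, hi⟩ : ∃ i, v i ≠ 0 := by
    by_contra! hc
    exact hv (by ext i; simpa using hc i)
  by_cases hcol : ∀ j, v i * w j = v j * w i
  · set c := w i / v i
    have hw : w = c • v := by
      ext j
      have := hcol j
      simp only [PiLp.smul_apply, smul_eq_mul, c]
      field_simp
      linarith
    have hx' : x = a + c • v := by rw [← hw, hw_def]; abel
    have hvp : 0 < ‖v‖ := norm_pos_iff.2 hv
    have h1 := hmax a ha x hx
    have h2 := hmax b hb x hx
    rw [show x - a = c • v from hw, norm_smul, Real.norm_eq_abs] at h1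
    rw [show x - b = (c - 1) • v by rw [hx', hv_def, sub_smul, one_smul]; abel, norm_smul,
      Real.norm_eq_abs] at h2
    have h1' : |c| ≤ 1 := by
      by_contra! hc
      nlinarith
    have h2' : |c - 1| ≤ 1 := by
      by_contra! hc
      nlinarith
    rw [segment_eq_image']
    exact ⟨c, ⟨by linarith [(abs_le.1 h2').1], (abs_le.1 h1').2⟩, hx'.symm⟩
  · exfalso
    push Not at hcol
    obtain ⟨j, hj⟩ := hcol
    have hij : i ≠ j := by
      rintro rfl
      exact hj rfl
    obtain ⟨r, s, σ, τ, hσ, hτ, hστ, er, es⟩ :=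
      exists_rat_mem_triangle (a i) (a j) (sub_ne_zero.2 hj)
    obtain ⟨α, β, hne, hα⟩ := h i j hij r s
    have pa := hα a ha
    have pb := hα b hb
    have px := hα x hx
    have bi : b i = a i + v i := by simp [hv_def]
    have bj : b j = a j + v j := by simp [hv_def]
    have xi : x i = a i + w i := by simp [hw_def]
    have xj : x j = a j + w j := by simp [hw_def]
    simp only [planarForm] at pa pb px
    rw [er, es] at pa pb px
    rw [bi, bj] at pb
    rw [xi, xj] at px
    obtain ⟨hα0, hβ0⟩ := eq_zero_of_nonneg_on_triangle (α := α) (β := β)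
      (sub_ne_zero.2 hj) hσ hτ hστ
      (by linarith) (by linarith) (by linarith)
    exact hne.elim (· hα0) (· hβ0)

end Bisection

section Needle

variable {n : ℕ} {Ω : Set (EuclideanSpace ℝ (Fin n))}

/-- Convex measurable subsets of `Ω` on which `u` has mean zero and `G` has negative integral. -/
structure IsNeedle (Ω : Set (EuclideanSpace ℝ (Fin n))) (u G : EuclideanSpace ℝ (Fin n) → ℝ)
    (K : Set (EuclideanSpace ℝ (Fin n))) : Prop where
  subset : K ⊆ Ω
  convex : Convex ℝ K
  measurableSet : MeasurableSet K
  integral_eq_zero : ∫ x in K, u x = 0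
  integral_neg : ∫ x in K, G x < 0

lemma convex_planarForm_nonneg (i j : Fin n) (r s α β : ℝ) :
    Convex ℝ {x | 0 ≤ planarForm i j r s α β x} := by
  intro x hx y hy p q hp hq hpq
  simp only [Set.mem_ofPred_eq, planarForm] at hx hy ⊢
  have : α * ((p • x + q • y) i - r) + β * ((p • x + q • y) j - s) =
      p * (α * (x i - r) + β * (x j - s)) + q * (α * (y i - r) + β * (y j - s)) := by
    simp only [PiLp.add_apply, PiLp.smul_apply, smul_eq_mul]
    linear_combination (α * r + β * s) * hpq
  rw [this]
  positivity

lemma IsNeedle.nonempty {u G : EuclideanSpace ℝ (Fin n) → ℝ} {K : Set (EuclideanSpace ℝ (Fin n))}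
    (hK : IsNeedle Ω u G K) : K.Nonempty := by
  rw [Set.nonempty_iff_ne_empty]
  rintro rfl
  simpa using hK.integral_neg

lemma IsNeedle.exists_bisection {u G : EuclideanSpace ℝ (Fin n) → ℝ}
    (hu : IntegrableOn u Ω) (hG : IntegrableOn G Ω) {K : Set (EuclideanSpace ℝ (Fin n))}
    (hK : IsNeedle Ω u G K) (i j : Fin n) (r s : ℝ) :
    ∃ K' ⊆ K, IsNeedle Ω u G K' ∧ (i ≠ j → ∃ α β : ℝ, (α ≠ 0 ∨ β ≠ 0) ∧
      ∀ x ∈ K', 0 ≤ planarForm i j r s α β x) := by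
  rcases eq_or_ne i j with h | hij
  · exact ⟨K, subset_rfl, hK, fun h' => absurd h h'⟩
  obtain ⟨α, β, hne, h1, h2⟩ := exists_bisecting_halfspace (hu.mono_set hK.subset)
    (hG.mono_set hK.subset) hK.integral_eq_zero hK.integral_neg hij r s
  refine ⟨_, Set.inter_subset_left, ⟨Set.inter_subset_left.trans hK.subset,
    hK.convex.inter (convex_planarForm_nonneg _ _ _ _ _ _), hK.measurableSet.inter
    (measurableSet_le measurable_const (continuous_planarForm _ _ _ _ _ _).measurable), h1, h2⟩,
    fun _ => ⟨α, β, hne, fun x hx => hx.2⟩⟩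

lemma exists_needles (hΩb : Bornology.IsBounded Ω) (hΩc : Convex ℝ Ω) (hΩm : MeasurableSet Ω)
    {u G : EuclideanSpace ℝ (Fin n) → ℝ} (hu : IntegrableOn u Ω) (hG : IntegrableOn G Ω)
    (hu0 : ∫ x in Ω, u x = 0) (hG0 : ∫ x in Ω, G x < 0) :
    ∃ a ∈ closure Ω, ∃ b ∈ closure Ω, ∀ η > 0, ∃ K, IsNeedle Ω u G K ∧
      K ⊆ Metric.thickening η (segment ℝ a b) := by
  have hΩ : IsNeedle Ω u G Ω := ⟨subset_rfl, hΩc, hΩm, hu0, hG0⟩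
  rcases isEmpty_or_nonempty (Fin n) with hn | hn
  · obtain ⟨a, ha⟩ := hΩ.nonempty
    refine ⟨a, subset_closure ha, a, subset_closure ha, fun η hη => ⟨Ω, hΩ, fun x _ => ?_⟩⟩
    rw [Subsingleton.elim x a]
    exact Metric.self_subset_thickening hη _ (left_mem_segment ℝ a a)
  obtain ⟨e, he⟩ := exists_surjective_nat (Fin n × Fin n × ℚ × ℚ)
  choose! next hnext_sub hnext hnext_form using
    fun (K : Set (EuclideanSpace ℝ (Fin n))) (hK : IsNeedle Ω u G K)
      (p : Fin n × Fin n × ℚ × ℚ) =>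
        hK.exists_bisection hu hG p.1 p.2.1 (p.2.2.1 : ℝ) (p.2.2.2 : ℝ)
  let K : ℕ → Set (EuclideanSpace ℝ (Fin n)) := fun m => Nat.rec Ω (fun k S => next S (e k)) m
  have hK : ∀ m, IsNeedle Ω u G (K m) := by
    intro m
    induction m with
    | zero => exact hΩ
    | succ m ih => exact hnext _ ih _
  have hKsub : ∀ m, K (m + 1) ⊆ K m := fun m => hnext_sub _ (hK m) _
  have hanti : Antitone fun m => closure (K m) :=
    antitone_nat_of_succ_le fun m => closure_mono (hKsub m)
  have hcomp : ∀ m, IsCompact (closure (K m)) := fun m =>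
    (hΩb.subset (hK m).subset).isCompact_closure
  have hX : IsCompact (⋂ m, closure (K m)) :=
    (hcomp 0).of_isClosed_subset (isClosed_iInter fun _ => isClosed_closure)
      (Set.iInter_subset _ 0)
  have hXn : (⋂ m, closure (K m)).Nonempty :=
    IsCompact.nonempty_iInter_of_sequence_nonempty_isCompact_isClosed _
      (fun m => hanti m.le_succ) (fun m => (hK m).nonempty.closure) (hcomp 0)
      fun _ => isClosed_closure
  obtain ⟨a, ha, b, hb, hab⟩ := exists_subset_segment hX hXn (by
    intro i j hij r s
    obtain ⟨m, hm⟩ := he (i, j, r, s)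
    obtain ⟨α, β, hne, hαβ⟩ := hnext_form (K m) (hK m) (i, j, r, s) hij
    refine ⟨α, β, hne, fun x hx => ?_⟩
    have hx' : x ∈ closure (K (m + 1)) := Set.mem_iInter.1 hx (m + 1)
    have hKm : K (m + 1) = next (K m) (i, j, r, s) := by rw [← hm]
    exact closure_minimal (hKm ▸ hαβ)
      (isClosed_le continuous_const (continuous_planarForm _ _ _ _ _ _)) hx')
  refine ⟨a, Set.mem_iInter.1 ha 0, b, Set.mem_iInter.1 hb 0, fun η hη => ?_⟩
  obtain ⟨m, hm⟩ := exists_subset_nhds_of_isCompact' hanti.directed_ge hcomp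
    (fun _ => isClosed_closure) (U := Metric.thickening η (segment ℝ a b)) fun x hx =>
      Metric.isOpen_thickening.mem_nhds (Metric.self_subset_thickening hη _ (hab hx))
  exact ⟨K m, hK m, subset_closure.trans hm⟩

end Needle

section MinkowskiNorm

variable {n : ℕ} {F : EuclideanSpace ℝ (Fin n) → ℝ}

lemma IsMinkowskiNorm.continuous (hF : IsMinkowskiNorm F) : Continuous F :=
  continuousOn_univ.1 (hF.convexOn.continuousOn isOpen_univ)

lemma IsMinkowskiNorm.map_zero (hF : IsMinkowskiNorm F) : F 0 = 0 := by
  simpa using hF.homog 0 0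

lemma IsMinkowskiNorm.exists_mul_norm_le (hF : IsMinkowskiNorm F) :
    ∃ m > 0, ∀ ξ, m * ‖ξ‖ ≤ F ξ := by
  rcases (Metric.sphere (0 : EuclideanSpace ℝ (Fin n)) 1).eq_empty_or_nonempty with h | h
  · refine ⟨1, one_pos, fun ξ => ?_⟩
    rcases eq_or_ne ξ 0 with rfl | hξ
    · simp [hF.map_zero]
    · have : ‖ξ‖⁻¹ • ξ ∈ Metric.sphere (0 : EuclideanSpace ℝ (Fin n)) 1 := by
        simp [norm_smul, hξ]
      simp [h] at this
  · obtain ⟨ζ, hζ, hmin⟩ := (isCompact_sphere (0 : EuclideanSpace ℝ (Fin n)) 1).exists_isMinOn h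
      hF.continuous.continuousOn
    refine ⟨F ζ, hF.pos ζ (ne_zero_of_mem_unit_sphere ⟨ζ, hζ⟩), fun ξ => ?_⟩
    rcases eq_or_ne ξ 0 with rfl | hξ
    · simp [hF.map_zero]
    have h1 : F ζ ≤ F (‖ξ‖⁻¹ • ξ) := hmin (by simp [norm_smul, hξ])
    rw [hF.homog, abs_of_nonneg (by positivity), inv_mul_eq_div, le_div_iff₀ (by positivity)] at h1
    exact h1

lemma IsMinkowskiNorm.inner_le_dualNorm_mul (hF : IsMinkowskiNorm F)
    (x ξ : EuclideanSpace ℝ (Fin n)) : ⟪x, ξ⟫ ≤ dualNorm F x * F ξ := by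
  rcases eq_or_ne ξ 0 with rfl | hξ
  · simp [hF.map_zero]
  obtain ⟨m, hm, hmF⟩ := hF.exists_mul_norm_le
  rw [← div_le_iff₀ (hF.pos ξ hξ)]
  refine le_csSup ⟨‖x‖ / m, ?_⟩ ⟨ξ, hξ, rfl⟩
  rintro _ ⟨ζ, hζ, rfl⟩
  rw [div_le_div_iff₀ (hF.pos ζ hζ) hm]
  calc ⟪x, ζ⟫ * m ≤ ‖x‖ * ‖ζ‖ * m := by gcongr; exact real_inner_le_norm x ζ
    _ = ‖x‖ * (m * ‖ζ‖) := by ring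
    _ ≤ ‖x‖ * F ζ := by gcongr; exact hmF ζ

lemma IsMinkowskiNorm.exists_dualNorm_le (hF : IsMinkowskiNorm F) :
    ∃ C, 0 ≤ C ∧ ∀ x, dualNorm F x ≤ C * ‖x‖ := by
  obtain ⟨m, hm, hmF⟩ := hF.exists_mul_norm_le
  refine ⟨m⁻¹, by positivity, fun x => Real.sSup_le ?_ (by positivity)⟩
  rintro _ ⟨ζ, hζ, rfl⟩
  rw [inv_mul_eq_div, div_le_div_iff₀ (hF.pos ζ hζ) hm]
  calc ⟪x, ζ⟫ * m ≤ ‖x‖ * ‖ζ‖ * m := by gcongr; exact real_inner_le_norm x ζ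
    _ = ‖x‖ * (m * ‖ζ‖) := by ring
    _ ≤ ‖x‖ * F ζ := by gcongr; exact hmF ζ

lemma IsMinkowskiNorm.inner_sub_le (hF : IsMinkowskiNorm F) {Ω : Set (EuclideanSpace ℝ (Fin n))}
    (hΩ : Bornology.IsBounded Ω) {a b : EuclideanSpace ℝ (Fin n)} (ha : a ∈ closure Ω)
    (hb : b ∈ closure Ω) (ξ : EuclideanSpace ℝ (Fin n)) :
    ⟪b - a, ξ⟫ ≤ sSup {d : ℝ | ∃ x₁ ∈ closure Ω, ∃ x₂ ∈ closure Ω,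
      d = dualNorm F (x₂ - x₁)} * F ξ := by
  refine (hF.inner_le_dualNorm_mul _ _).trans (mul_le_mul_of_nonneg_right ?_ (hF.nonneg ξ))
  obtain ⟨C, hC, hCF⟩ := hF.exists_dualNorm_le
  refine le_csSup ⟨C * Metric.diam (closure Ω), ?_⟩ ⟨a, ha, b, hb, rfl⟩
  rintro _ ⟨x, hx, y, hy, rfl⟩
  refine (hCF _).trans (mul_le_mul_of_nonneg_left ?_ hC)
  rw [← dist_eq_norm]
  exact Metric.dist_le_diam_of_mem hΩ.closure hy hx

end MinkowskiNorm

section NeedleEstimate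

variable {n : ℕ} {K Z : Set (EuclideanSpace ℝ (Fin n))}

lemma integrableOn_of_continuousOn_of_bound {w : EuclideanSpace ℝ (Fin n) → ℝ} {C : ℝ}
    (hKm : MeasurableSet K) (hKb : Bornology.IsBounded K) (hw : ContinuousOn w K)
    (hC : ∀ x ∈ K, |w x| ≤ C) : IntegrableOn w K :=
  IntegrableOn.of_bound hKb.measure_lt_top (hw.aestronglyMeasurable hKm) C
    ((ae_restrict_iff' hKm).2 (.of_forall hC))

lemma setIntegral_sub_const_mul_add_const {v w : EuclideanSpace ℝ (Fin n) → ℝ}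
    (hK : volume K ≠ ⊤) (hv : IntegrableOn v K) (hw : IntegrableOn w K) (c δ : ℝ) :
    ∫ x in K, (v x - c * w x + δ) =
      (∫ x in K, v x) - c * (∫ x in K, w x) + volume.real K * δ := by
  have hcw : IntegrableOn (fun x => c * w x) K := hw.const_mul c
  have hsub : IntegrableOn (fun x => v x - c * w x) K := hv.sub hcw
  rw [integral_add hsub (integrableOn_const hK), integral_sub hv hcw, integral_const_mul,
    setIntegral_const, smul_eq_mul]

lemma sq_le_sq_add_of_abs_sub_le {p q M ε : ℝ} (hp : |p| ≤ M) (hq : |q| ≤ M)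
    (h : |p - q| ≤ ε) : p ^ 2 ≤ q ^ 2 + 2 * M * ε := by
  have h1 : (p - q) * (p + q) ≤ |p - q| * |p + q| := by
    rw [← abs_mul]
    exact le_abs_self _
  have h2 : |p + q| ≤ 2 * M := (abs_add_le p q).trans (by linarith)
  have h3 : |p - q| * |p + q| ≤ ε * (2 * M) :=
    mul_le_mul h h2 (abs_nonneg _) ((abs_nonneg _).trans h)
  linarith

lemma setIntegral_sq_le_of_abs_sub_le {v w : EuclideanSpace ℝ (Fin n) → ℝ} {M ε : ℝ}
    (hKm : MeasurableSet K) (hKb : Bornology.IsBounded K)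
    (hv : IntegrableOn (fun x => v x ^ 2) K) (hw : IntegrableOn (fun x => w x ^ 2) K)
    (hvM : ∀ x ∈ K, |v x| ≤ M) (hwM : ∀ x ∈ K, |w x| ≤ M) (h : ∀ x ∈ K, |v x - w x| ≤ ε) :
    ∫ x in K, v x ^ 2 ≤ (∫ x in K, w x ^ 2) + 2 * M * ε * volume.real K := by
  have hc : IntegrableOn (fun _ : EuclideanSpace ℝ (Fin n) => 2 * M * ε) K :=
    integrableOn_const hKb.measure_lt_top.ne
  have := setIntegral_mono_on hv (hw.add hc) hKm fun x hx =>
    sq_le_sq_add_of_abs_sub_le (hvM x hx) (hwM x hx) (h x hx)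
  simp only [Pi.add_apply] at this
  rw [integral_add hw hc, setIntegral_const, smul_eq_mul, mul_comm (volume.real K)] at this
  exact this

lemma dist_projection_lt {a e x : EuclideanSpace ℝ (Fin n)} (he : ‖e‖ = 1) {L η : ℝ} (hL : 0 ≤ L)
    (hx : x ∈ Metric.thickening η (segment ℝ a (a + L • e))) :
    ⟪e, x⟫ - ⟪e, a⟫ ∈ Set.Ioo (-η) (L + η) ∧
      dist x (a + (⟪e, x⟫ - ⟪e, a⟫) • e) < 2 * η := by
  obtain ⟨p, hp, hxp⟩ := Metric.mem_thickening_iff.1 hx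
  rw [segment_eq_image'] at hp
  obtain ⟨θ, ⟨hθ0, hθ1⟩, rfl⟩ := hp
  simp only [add_sub_cancel_left, smul_smul] at hxp
  obtain ⟨t, ht⟩ : ∃ t, t = θ * L := ⟨_, rfl⟩
  have ht0 : 0 ≤ t := ht ▸ mul_nonneg hθ0 hL
  have htL : t ≤ L := ht ▸ mul_le_of_le_one_left hL hθ1
  rw [← ht] at hxp
  have hin : ⟪e, x - (a + t • e)⟫ = ⟪e, x⟫ - ⟪e, a⟫ - t := by
    rw [inner_sub_right, inner_add_right, inner_smul_right, real_inner_self_eq_norm_sq, he]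
    ring
  have habs : |⟪e, x⟫ - ⟪e, a⟫ - t| < η := by
    rw [← hin]
    refine (abs_real_inner_le_norm _ _).trans_lt ?_
    rwa [he, one_mul, ← dist_eq_norm]
  refine ⟨⟨by linarith [(abs_lt.1 habs).1], by linarith [(abs_lt.1 habs).2]⟩, ?_⟩
  have hd : dist (a + t • e) (a + (⟪e, x⟫ - ⟪e, a⟫) • e) < η := by
    rw [dist_add_left, dist_eq_norm, ← sub_smul, norm_smul, he, mul_one, Real.norm_eq_abs,
      abs_sub_comm]
    exact habs
  linarith [dist_triangle x (a + t • e) (a + (⟪e, x⟫ - ⟪e, a⟫) • e)]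

lemma needle_estimate (hKm : MeasurableSet K) (hKb : Bornology.IsBounded K) (hKc : Convex ℝ K)
    (hK0 : volume K ≠ 0) (hKZ : K ⊆ Z) {u : EuclideanSpace ℝ (Fin n) → ℝ}
    {g : EuclideanSpace ℝ (Fin n) → EuclideanSpace ℝ (Fin n)}
    (hug : ∀ z ∈ Z, HasGradientAt u (g z) z) (hg : ContinuousOn g Z) {M ε η L : ℝ}
    (huM : ∀ z ∈ Z, |u z| ≤ M) (hgM : ∀ z ∈ Z, ‖g z‖ ≤ M) (hη : 0 < η) (hL : 0 ≤ L)
    (humod : ∀ x ∈ Z, ∀ y ∈ Z, dist x y < 2 * η → |u x - u y| ≤ ε)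
    (hgmod : ∀ x ∈ Z, ∀ y ∈ Z, dist x y < 2 * η → ‖g x - g y‖ ≤ ε)
    {a e : EuclideanSpace ℝ (Fin n)} (he : ‖e‖ = 1)
    (hKs : K ⊆ Metric.thickening η (segment ℝ a (a + L • e)))
    (hline : ∀ t ∈ Set.Icc (-(2 * η)) (L + 2 * η), a + t • e ∈ Z) (hu0 : ∫ x in K, u x = 0) :
    (∫ x in K, u x ^ 2) - (2 * M * ε + ε ^ 2) * volume.real K ≤
      ((L + 4 * η) / π) ^ 2 * ((∫ x in K, ⟪g x, e⟫ ^ 2) + 2 * M * ε * volume.real K) := by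
  have huc : ContinuousOn u Z := fun z hz => (hug z hz).continuousAt.continuousWithinAt
  let ψ : ℝ → EuclideanSpace ℝ (Fin n) := fun s => a + (s - ⟪e, a⟫) • e
  have hψc : Continuous ψ := by fun_prop
  have hψd : ∀ s, HasDerivAt ψ e s := fun s => by
    have := (((hasDerivAt_id s).sub_const ⟪e, a⟫).smul_const e).const_add a
    rwa [one_smul] at this
  have hψZ : Set.MapsTo ψ (Set.Icc (⟪e, a⟫ - 2 * η) (⟪e, a⟫ + L + 2 * η)) Z := fun s hs =>
    hline _ ⟨by linarith [hs.1], by linarith [hs.2]⟩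
  let φ : EuclideanSpace ℝ (Fin n) →L[ℝ] ℝ := innerSL ℝ e
  have hφ : ∀ x, φ x = ⟪e, x⟫ := fun x => rfl
  have hφK : ∀ x ∈ K, φ x ∈ Set.Ioo (⟪e, a⟫ - 2 * η) (⟪e, a⟫ + L + 2 * η) := fun x hx => by
    have := (dist_projection_lt he hL (hKs hx)).1
    rw [hφ]
    exact ⟨by linarith [this.1], by linarith [this.2]⟩
  have hKψ : Set.MapsTo (fun x => ψ (φ x)) K Z := fun x hx =>
    hψZ (Set.Ioo_subset_Icc_self (hφK x hx))
  have hdist : ∀ x ∈ K, dist x (ψ (φ x)) < 2 * η := fun x hx =>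
    (dist_projection_lt he hL (hKs hx)).2
  have hψφ : ContinuousOn (fun x => ψ (φ x)) K := (hψc.comp φ.continuous).continuousOn
  have hin : ∀ z : EuclideanSpace ℝ (Fin n), |⟪z, e⟫| ≤ ‖z‖ := fun z => by
    simpa [he] using abs_real_inner_le_norm z e
  have hinM : ∀ z ∈ Z, |⟪g z, e⟫| ≤ M := fun z hz => (hin _).trans (hgM z hz)
  have key := poincare_marginal (φ := φ) (f := fun s => u (ψ s)) (f' := fun s => ⟪g (ψ s), e⟫)
    hKm hKb hKc hK0 (by linarith) hφK (huc.comp hψc.continuousOn hψZ)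
    (fun s hs => by
      have := (hug _ (hψZ (Set.Ioo_subset_Icc_self hs))).hasFDerivAt.comp_hasDerivAt s (hψd s)
      rw [InnerProductSpace.toDual_apply_apply] at this
      exact this)
    ((hg.comp hψc.continuousOn hψZ).inner continuousOn_const)
  have hsq : ∀ {w : EuclideanSpace ℝ (Fin n) → ℝ}, ContinuousOn w K → (∀ x ∈ K, |w x| ≤ M) →
      IntegrableOn (fun x => w x ^ 2) K := fun hw hwM =>
    integrableOn_of_continuousOn_of_bound (C := M ^ 2) hKm hKb (hw.pow 2) fun x hx => by
      rw [abs_pow]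
      exact pow_le_pow_left₀ (abs_nonneg _) (hwM x hx) 2
  have huK := huc.mono hKZ
  have hgK : ContinuousOn (fun x => ⟪g x, e⟫) K := (hg.mono hKZ).inner continuousOn_const
  have hfK : ContinuousOn (fun x => u (ψ (φ x))) K := huc.comp hψφ hKψ
  have hf'K : ContinuousOn (fun x => ⟪g (ψ (φ x)), e⟫) K :=
    (hg.comp hψφ hKψ).inner continuousOn_const
  have h1 : ∫ x in K, u x ^ 2 ≤ (∫ x in K, u (ψ (φ x)) ^ 2) + 2 * M * ε * volume.real K :=
    setIntegral_sq_le_of_abs_sub_le hKm hKb (hsq huK fun x hx => huM x (hKZ hx))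
      (hsq hfK fun x hx => huM _ (hKψ hx)) (fun x hx => huM x (hKZ hx))
      (fun x hx => huM _ (hKψ hx)) fun x hx => humod _ (hKZ hx) _ (hKψ hx) (hdist x hx)
  have h2 : ∫ x in K, ⟪g (ψ (φ x)), e⟫ ^ 2 ≤
      (∫ x in K, ⟪g x, e⟫ ^ 2) + 2 * M * ε * volume.real K :=
    setIntegral_sq_le_of_abs_sub_le hKm hKb (hsq hf'K fun x hx => hinM _ (hKψ hx))
      (hsq hgK fun x hx => hinM x (hKZ hx)) (fun x hx => hinM _ (hKψ hx))
      (fun x hx => hinM x (hKZ hx)) fun x hx => by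
        rw [← inner_sub_left]
        exact (hin _).trans (hgmod _ (hKψ hx) _ (hKZ hx) (by rw [dist_comm]; exact hdist x hx))
  have h3 : |∫ x in K, u (ψ (φ x))| ≤ ε * volume.real K := by
    have hi1 := integrableOn_of_continuousOn_of_bound hKm hKb hfK fun x hx => huM _ (hKψ hx)
    have hi2 := integrableOn_of_continuousOn_of_bound hKm hKb huK fun x hx => huM x (hKZ hx)
    have : ∫ x in K, u (ψ (φ x)) = ∫ x in K, (u (ψ (φ x)) - u x) := by
      rw [integral_sub hi1 hi2, hu0, sub_zero]
    rw [this, ← Real.norm_eq_abs]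
    refine norm_setIntegral_le_of_norm_le_const hKb.measure_lt_top fun x hx => ?_
    exact humod _ (hKψ hx) _ (hKZ hx) (by rw [dist_comm]; exact hdist x hx)
  have hv : 0 < volume.real K := ENNReal.toReal_pos hK0 hKb.measure_lt_top.ne
  have h4 : (∫ x in K, u (ψ (φ x))) ^ 2 ≤ (ε * volume.real K) ^ 2 := by
    rw [← sq_abs]
    exact pow_le_pow_left₀ (abs_nonneg _) h3 2
  rw [show ⟪e, a⟫ + L + 2 * η - (⟪e, a⟫ - 2 * η) = L + 4 * η by ring] at key
  refine le_of_mul_le_mul_left ?_ hv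
  have h5 := mul_le_mul_of_nonneg_left (mul_le_mul_of_nonneg_left h2 hv.le)
    (sq_nonneg ((L + 4 * η) / π))
  have h6 := mul_le_mul_of_nonneg_left h1 hv.le
  linarith

end NeedleEstimate

lemma exists_uniform_modulus {n : ℕ} {Z : Set (EuclideanSpace ℝ (Fin n))} (hZ : IsCompact Z)
    {E : Type*} [NormedAddCommGroup E] {w : EuclideanSpace ℝ (Fin n) → E}
    (hw : ContinuousOn w Z) {ε : ℝ} (hε : 0 < ε) :
    ∃ η > 0, ∀ x ∈ Z, ∀ y ∈ Z, dist x y < η → ‖w x - w y‖ ≤ ε := by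
  obtain ⟨η, hη, h⟩ := Metric.uniformContinuousOn_iff.1 (hZ.uniformContinuousOn_of_continuous hw)
    ε hε
  exact ⟨η, hη, fun x hx y hy hxy => by simpa [dist_eq_norm] using (h x hx y hy hxy).le⟩

lemma exists_eq_smul_unit {n : ℕ} (hn : 1 ≤ n) (z : EuclideanSpace ℝ (Fin n)) :
    ∃ L : ℝ, 0 ≤ L ∧ ∃ e : EuclideanSpace ℝ (Fin n), ‖e‖ = 1 ∧ z = L • e := by
  rcases eq_or_ne z 0 with rfl | hz
  · exact ⟨0, le_rfl, EuclideanSpace.single ⟨0, hn⟩ 1, by simp, by simp⟩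
  · exact ⟨‖z‖, norm_nonneg z, ‖z‖⁻¹ • z, by simp [norm_smul, hz],
      by rw [smul_smul, mul_inv_cancel₀ (norm_ne_zero_iff.2 hz), one_smul]⟩

lemma exists_small_error {D δ : ℝ} (hD : 0 < D) (hδ : 0 < δ) (L M : ℝ) :
    ∃ ε > 0, π ^ 2 * (2 * M * ε + ε ^ 2) + (8 * L * ε + 16 * ε ^ 2) * M ^ 2 +
      (L + 4 * ε) ^ 2 * (2 * M * ε) < D ^ 2 * δ := by
  have hc : Continuous fun ε : ℝ => π ^ 2 * (2 * M * ε + ε ^ 2) +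
      (8 * L * ε + 16 * ε ^ 2) * M ^ 2 + (L + 4 * ε) ^ 2 * (2 * M * ε) := by fun_prop
  have h0 : ∀ᶠ ε in nhds (0 : ℝ), π ^ 2 * (2 * M * ε + ε ^ 2) +
      (8 * L * ε + 16 * ε ^ 2) * M ^ 2 + (L + 4 * ε) ^ 2 * (2 * M * ε) < D ^ 2 * δ := by
    refine hc.continuousAt.eventually_lt continuousAt_const ?_
    simp only [mul_zero, zero_pow two_ne_zero, add_zero, zero_mul]
    positivity
  obtain ⟨ε, h, hε⟩ := ((h0.filter_mono nhdsWithin_le_nhds).and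
    (self_mem_nhdsWithin (s := Set.Ioi (0 : ℝ)))).exists
  exact ⟨ε, hε, h⟩

lemma needle_lower_bound {U P Q v L η ε M D : ℝ} (hv : 0 ≤ v) (hL : 0 ≤ L) (hη : 0 ≤ η)
    (hηε : η ≤ ε) (hM : 0 ≤ M)
    (h : U - (2 * M * ε + ε ^ 2) * v ≤ ((L + 4 * η) / π) ^ 2 * (Q + 2 * M * ε * v))
    (hQ0 : 0 ≤ Q) (hQ : Q ≤ M ^ 2 * v) (hP : L ^ 2 * Q ≤ D ^ 2 * P) :
    π ^ 2 * U - D ^ 2 * P ≤ (π ^ 2 * (2 * M * ε + ε ^ 2) + (8 * L * ε + 16 * ε ^ 2) * M ^ 2 +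
      (L + 4 * ε) ^ 2 * (2 * M * ε)) * v := by
  have hπ : 0 < π ^ 2 := by positivity
  have hε : 0 ≤ ε := hη.trans hηε
  rw [div_pow, div_mul_eq_mul_div, le_div_iff₀ hπ] at h
  have h1 : (L + 4 * η) ^ 2 ≤ (L + 4 * ε) ^ 2 := by gcongr
  have h2 : (L + 4 * η) ^ 2 * (Q + 2 * M * ε * v) ≤ (L + 4 * ε) ^ 2 * (Q + 2 * M * ε * v) := by
    gcongr
  have h3 : (8 * L * ε + 16 * ε ^ 2) * Q ≤ (8 * L * ε + 16 * ε ^ 2) * (M ^ 2 * v) := by gcongr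
  linarith

section Main

variable {n : ℕ} {Ω V : Set (EuclideanSpace ℝ (Fin n))} {F u : EuclideanSpace ℝ (Fin n) → ℝ}

lemma integrableOn_of_continuousOn_closure (hbd : Bornology.IsBounded Ω)
    {w : EuclideanSpace ℝ (Fin n) → ℝ} (hw : ContinuousOn w (closure Ω)) : IntegrableOn w Ω :=
  (hw.integrableOn_compact hbd.isCompact_closure).mono_set subset_closure

lemma continuousOn_gradient (hV : IsOpen V) (hu : ContDiffOn ℝ 1 u V) :
    ContinuousOn (gradient u) V :=
  (InnerProductSpace.toDual ℝ (EuclideanSpace ℝ (Fin n))).symm.continuous.comp_continuousOn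
    (hu.continuousOn_fderiv_of_isOpen hV le_rfl)

lemma setIntegral_needle_nonneg (hn : 1 ≤ n) (hbd : Bornology.IsBounded Ω)
    (hconv : Convex ℝ Ω) (hF : IsMinkowskiNorm F) {D : ℝ} (hD : 0 < D)
    (hDF : ∀ a ∈ closure Ω, ∀ b ∈ closure Ω, ∀ ξ, ⟪b - a, ξ⟫ ≤ D * F ξ)
    (hV : IsOpen V) (hΩV : closure Ω ⊆ V) (hu : ContDiffOn ℝ 1 u V) (hΩm : MeasurableSet Ω)
    (hmean : ∫ x in Ω, u x = 0) {δ : ℝ} (hδ : 0 < δ) :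
    0 ≤ ∫ x in Ω, (F (gradient u x) ^ 2 - π ^ 2 / D ^ 2 * u x ^ 2 + δ) := by
  by_contra! hneg
  have hgV := continuousOn_gradient hV hu
  have huV := hu.continuousOn
  have hFgV : ContinuousOn (fun x => F (gradient u x) ^ 2) V :=
    (hF.continuous.comp_continuousOn hgV).pow 2
  have hGV : ContinuousOn (fun x => F (gradient u x) ^ 2 - π ^ 2 / D ^ 2 * u x ^ 2 + δ) V :=
    (hFgV.sub (continuousOn_const.mul (huV.pow 2))).add continuousOn_const
  obtain ⟨a, ha, b, hb, hab⟩ := exists_needles hbd hconv hΩm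
    (integrableOn_of_continuousOn_closure hbd (huV.mono hΩV))
    (integrableOn_of_continuousOn_closure hbd (hGV.mono hΩV)) hmean hneg
  obtain ⟨ρ, hρ, hZV⟩ := hbd.isCompact_closure.exists_cthickening_subset_open hV hΩV
  have hZ : IsCompact (Metric.cthickening ρ (closure Ω)) := hbd.isCompact_closure.cthickening
  have hΩZ : closure Ω ⊆ Metric.cthickening ρ (closure Ω) := Metric.self_subset_cthickening _
  obtain ⟨M₁, hM₁⟩ := hZ.exists_bound_of_continuousOn (huV.mono hZV)
  obtain ⟨M₂, hM₂⟩ := hZ.exists_bound_of_continuousOn (hgV.mono hZV)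
  obtain ⟨M, hM⟩ : ∃ M, M = max M₁ M₂ := ⟨_, rfl⟩
  have huM : ∀ z ∈ Metric.cthickening ρ (closure Ω), |u z| ≤ M := fun z hz =>
    (hM₁ z hz).trans (hM ▸ le_max_left _ _)
  have hgM : ∀ z ∈ Metric.cthickening ρ (closure Ω), ‖gradient u z‖ ≤ M := fun z hz =>
    (hM₂ z hz).trans (hM ▸ le_max_right _ _)
  have hM0 : 0 ≤ M := (abs_nonneg _).trans (huM a (hΩZ ha))
  obtain ⟨L, hL, e, he, hLe⟩ := exists_eq_smul_unit hn (b - a)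
  have hb' : b = a + L • e := by rw [← hLe]; abel
  obtain ⟨ε, hε, herr⟩ := exists_small_error hD hδ L M
  obtain ⟨η₁, hη₁, hmod₁⟩ := exists_uniform_modulus hZ (huV.mono hZV) hε
  obtain ⟨η₂, hη₂, hmod₂⟩ := exists_uniform_modulus hZ (hgV.mono hZV) hε
  obtain ⟨η, hη, hle⟩ : ∃ η > 0, η ≤ ε ∧ 2 * η ≤ η₁ ∧ 2 * η ≤ η₂ ∧ 2 * η ≤ ρ := by
    refine ⟨min (min ε (ρ / 2)) (min (η₁ / 2) (η₂ / 2)), by positivity, ?_, ?_, ?_, ?_⟩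
    · exact (min_le_left _ _).trans (min_le_left _ _)
    · linarith [(min_le_right (min ε (ρ / 2)) _).trans (min_le_left (η₁ / 2) (η₂ / 2))]
    · linarith [(min_le_right (min ε (ρ / 2)) _).trans (min_le_right (η₁ / 2) (η₂ / 2))]
    · linarith [(min_le_left _ (min (η₁ / 2) (η₂ / 2))).trans (min_le_right ε (ρ / 2))]
  obtain ⟨hηε, hηη₁, hηη₂, hηρ⟩ := hle
  obtain ⟨K, hK, hKs⟩ := hab η hη
  rw [hb'] at hKs
  have hKb := hbd.subset hK.subset
  have hKΩ : K ⊆ closure Ω := hK.subset.trans subset_closure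
  have hK0 : volume K ≠ 0 := fun h0 => by
    have := hK.integral_neg
    rw [Measure.restrict_eq_zero.2 h0, integral_zero_measure] at this
    exact this.false
  have hline : ∀ t ∈ Set.Icc (-(2 * η)) (L + 2 * η),
      a + t • e ∈ Metric.cthickening ρ (closure Ω) := by
    intro t ht
    have hs : ∀ s ∈ Set.Icc 0 L, a + s • e ∈ closure Ω := by
      intro s hs
      rcases hL.eq_or_lt with h0 | h0
      · have : s = 0 := le_antisymm (h0 ▸ hs.2) hs.1
        simpa [this] using ha
      · have := hconv.closure.add_smul_sub_mem ha hb (t := s / L)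
          ⟨div_nonneg hs.1 hL, (div_le_one h0).2 hs.2⟩
        rwa [hLe, smul_smul, div_mul_cancel₀ _ h0.ne'] at this
    obtain ⟨s, hsL, hts⟩ : ∃ s ∈ Set.Icc 0 L, |t - s| ≤ 2 * η := by
      refine ⟨max 0 (min t L), ⟨le_max_left _ _, max_le hL (min_le_right _ _)⟩, ?_⟩
      rw [abs_le]
      rcases le_total t 0 with h | h
      · rw [min_eq_left (h.trans hL), max_eq_left h]
        exact ⟨by linarith [ht.1], by linarith⟩
      · rcases le_total t L with h' | h'
        · rw [min_eq_left h', max_eq_right h]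
          exact ⟨by linarith, by linarith⟩
        · rw [min_eq_right h', max_eq_right hL]
          exact ⟨by linarith, by linarith [ht.2]⟩
    refine Metric.mem_cthickening_of_dist_le _ _ _ _ (hs s hsL) ?_
    rw [dist_add_left, dist_eq_norm, ← sub_smul, norm_smul, he, mul_one, Real.norm_eq_abs]
    linarith
  have hest := needle_estimate (g := gradient u) hK.measurableSet hKb hK.convex hK0
    (hKΩ.trans hΩZ)
    (fun z hz => ((hu.contDiffAt (hV.mem_nhds (hZV hz))).differentiableAt one_ne_zero).hasGradientAt)
    (hgV.mono hZV) huM hgM hη hL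
    (fun x hx y hy hxy => hmod₁ x hx y hy (hxy.trans_le hηη₁))
    (fun x hx y hy hxy => hmod₂ x hx y hy (hxy.trans_le hηη₂)) he hKs hline hK.integral_eq_zero
  have hint : ∀ {w : EuclideanSpace ℝ (Fin n) → ℝ}, ContinuousOn w V → IntegrableOn w K :=
    fun hw => (integrableOn_of_continuousOn_closure hbd (hw.mono hΩV)).mono_set hK.subset
  have hinner : ContinuousOn (fun x => ⟪gradient u x, e⟫ ^ 2) V :=
    (hgV.inner continuousOn_const).pow 2
  have hQ0 : 0 ≤ ∫ x in K, ⟪gradient u x, e⟫ ^ 2 := integral_nonneg fun x => sq_nonneg _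
  have hQ : ∫ x in K, ⟪gradient u x, e⟫ ^ 2 ≤ M ^ 2 * volume.real K := by
    have := setIntegral_mono_on (hint hinner) (integrableOn_const hKb.measure_lt_top.ne (C := M ^ 2))
      hK.measurableSet fun x hx => by
        rw [← sq_abs]
        refine pow_le_pow_left₀ (abs_nonneg _) ((abs_real_inner_le_norm _ _).trans ?_) 2
        rw [he, mul_one]
        exact hgM x (hΩZ (hKΩ hx))
    rwa [setIntegral_const, smul_eq_mul, mul_comm] at this
  have hP : L ^ 2 * ∫ x in K, ⟪gradient u x, e⟫ ^ 2 ≤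
      D ^ 2 * ∫ x in K, F (gradient u x) ^ 2 := by
    rw [← integral_const_mul, ← integral_const_mul]
    refine setIntegral_mono_on ((hint hinner).const_mul _) ((hint hFgV).const_mul _)
      hK.measurableSet fun x _ => ?_
    rw [← mul_pow, ← mul_pow, ← sq_abs]
    refine pow_le_pow_left₀ (abs_nonneg _) (abs_le.2 ⟨?_, ?_⟩) 2
    · have := hDF b hb a ha (gradient u x)
      rw [← neg_sub, hLe, inner_neg_left, real_inner_smul_left, real_inner_comm] at this
      linarith
    · have := hDF a ha b hb (gradient u x)
      rwa [hLe, real_inner_smul_left, real_inner_comm] at this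
  have hlow := needle_lower_bound measureReal_nonneg hL hη.le hηε hM0 hest hQ0 hQ hP
  have hGK := hK.integral_neg
  have hu2 : ContinuousOn (fun x => u x ^ 2) V := huV.pow 2
  rw [setIntegral_sub_const_mul_add_const hKb.measure_lt_top.ne (hint hFgV) (hint hu2)] at hGK
  have hfin := mul_neg_of_pos_of_neg (pow_pos hD 2) hGK
  have hrew : D ^ 2 * ((∫ x in K, F (gradient u x) ^ 2) - π ^ 2 / D ^ 2 * (∫ x in K, u x ^ 2) +
      volume.real K * δ) = D ^ 2 * (∫ x in K, F (gradient u x) ^ 2) - π ^ 2 * (∫ x in K, u x ^ 2) +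
      D ^ 2 * δ * volume.real K := by
    field_simp
  rw [hrew] at hfin
  have := mul_le_mul_of_nonneg_right herr.le (measureReal_nonneg (μ := volume) (s := K))
  linarith

end Main

/-- Optimal anisotropic Poincaré inequality for convex domains:
`∫_Ω F(∇u)² ≥ (π²/d_F²) ∫_Ω u²` for `u` of zero mean. -/
theorem anisotropic_poincare {n : ℕ} (hn : 1 ≤ n)
    (Ω : Set (EuclideanSpace ℝ (Fin n))) (hne : Ω.Nonempty)
    (hbd : Bornology.IsBounded Ω) (hop : IsOpen Ω) (hconv : Convex ℝ Ω)
    (hsb : HasSmoothBoundary Ω)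
    (F : EuclideanSpace ℝ (Fin n) → ℝ) (hF : IsMinkowskiNorm F)
    (dF : ℝ)
    (hdF : dF = sSup {d : ℝ | ∃ x₁ ∈ closure Ω, ∃ x₂ ∈ closure Ω,
      d = dualNorm F (x₂ - x₁)})
    (u : EuclideanSpace ℝ (Fin n) → ℝ) (V : Set (EuclideanSpace ℝ (Fin n)))
    (hV : IsOpen V) (hΩV : closure Ω ⊆ V) (hu : ContDiffOn ℝ 1 u V)
    (hmean : ∫ x in Ω, u x = 0) :
    (π ^ 2 / dF ^ 2) * ∫ x in Ω, (u x) ^ 2 ≤ ∫ x in Ω, F (gradient u x) ^ 2 := by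
  have hbound : ∀ a ∈ closure Ω, ∀ b ∈ closure Ω, ∀ ξ, ⟪b - a, ξ⟫ ≤ dF * F ξ :=
    fun a ha b hb ξ => hdF ▸ hF.inner_sub_le hbd ha hb ξ
  have hdF0 : 0 ≤ dF := by
    obtain ⟨a, ha⟩ := hne
    have h := hbound a (subset_closure ha) a (subset_closure ha)
      (EuclideanSpace.single ⟨0, hn⟩ 1)
    rw [sub_self, inner_zero_left] at h
    exact nonneg_of_mul_nonneg_left h (hF.pos _ (by simp))
  rcases hdF0.eq_or_lt with h0 | hD
  · rw [← h0]
    simpa using integral_nonneg fun x => sq_nonneg (F (gradient u x))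
  have hgV := continuousOn_gradient hV hu
  have hFi : IntegrableOn (fun x => F (gradient u x) ^ 2) Ω :=
    integrableOn_of_continuousOn_closure hbd
      (((hF.continuous.comp_continuousOn hgV).pow 2).mono hΩV)
  have hui : IntegrableOn (fun x => u x ^ 2) Ω :=
    integrableOn_of_continuousOn_closure hbd ((hu.continuousOn.pow 2).mono hΩV)
  have hδ : ∀ δ > 0, π ^ 2 / dF ^ 2 * ∫ x in Ω, u x ^ 2 ≤
      (∫ x in Ω, F (gradient u x) ^ 2) + volume.real Ω * δ := by
    intro δ hδ
    have h := setIntegral_needle_nonneg hn hbd hconv hF hD hbound hV hΩV hu hop.measurableSet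
      hmean hδ
    rw [setIntegral_sub_const_mul_add_const hbd.measure_lt_top.ne hFi hui] at h
    linarith
  have hv : 0 < volume.real Ω :=
    ENNReal.toReal_pos (hop.measure_pos volume hne).ne' hbd.measure_lt_top.ne
  refine le_of_forall_pos_le_add fun ε hε => ?_
  have h := hδ (ε / volume.real Ω) (div_pos hε hv)
  rwa [mul_div_cancel₀ _ hv.ne'] at h
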